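/- arXiv:1812.04902 — 3 statements merged into one kernel-verified Lean document; each statement's English description precedes it below -/
import Mathlib

section
/- Let T₀ ∈ (0,∞) and let f : (0,T₀] → 𝔹 be strongly measurable with ∫₀^{T₀} ‖f(t)‖ dt < ∞. Then u(t) := ∫₀^t ∫₀^∞ P⁰_r f(s) p̄(r, t−s) dr ds is well defined as a Bochner integral in 𝔹 for a.e. t ∈ (0,T₀] and ∫₀^{T₀} ‖u(t)‖ dt < ∞. Moreover, for every T ∈ (0,T₀]: ∫₀^T w(T−t) ‖u(t)‖ dt ≤ M ∫₀^T ‖f(s)‖ ds < ∞, and ∫₀^T w(T−t) u(t) dt = ∫₀^T ∫₀^∞ P⁰_r f(s) (∫₀^{T−s} w(T−s−v) p̄(r,v) dv) dr ds as elements of 𝔹 (the inner expression is the expectation E[P⁰_{E_{T−s}} f(s)] written via the density of the inverse subordinator). -/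
open MeasureTheory Filter Set
open scoped ENNReal Topology

/-- Finite measures on `[0,∞)` with equal Laplace transforms at all natural numbers are equal. -/
theorem NNReal.measure_ext_of_integral_exp_neg {ρ₁ ρ₂ : Measure NNReal}
    [IsFiniteMeasure ρ₁] [IsFiniteMeasure ρ₂]
    (h : ∀ n : ℕ, ∫ x : NNReal, Real.exp (-(n * (x : ℝ))) ∂ρ₁
      = ∫ x : NNReal, Real.exp (-(n * (x : ℝ))) ∂ρ₂) : ρ₁ = ρ₂ := by
  let e : BoundedContinuousFunction NNReal ℝ :=
    BoundedContinuousFunction.ofNormedAddCommGroup (fun x : NNReal => Real.exp (-(x : ℝ)))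
      (by fun_prop) 1 (fun x => by
        rw [Real.norm_eq_abs, Real.abs_exp]
        exact Real.exp_le_one_iff.2 (by simp))
  have he : ∀ x, e x = Real.exp (-(x : ℝ)) := fun x => rfl
  let A : StarSubalgebra ℝ (BoundedContinuousFunction NNReal ℝ) :=
    { Algebra.adjoin ℝ {e} with
      star_mem' := fun {a} ha => by
        have : star a = a := by ext x; simp
        rw [this]; exact ha }
  refine ext_of_forall_mem_subalgebra_integral_eq_of_pseudoEMetric_complete_countable
    (𝕜 := ℝ) (A := A) ?_ ?_
  · intro x y hxy
    refine ⟨e, ⟨_, ⟨e, Algebra.subset_adjoin rfl, rfl⟩, rfl⟩, ?_⟩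
    rw [he, he]
    intro hh
    exact hxy (NNReal.coe_injective (neg_injective (Real.exp_injective hh)))
  · intro g hg
    have hg' : g ∈ Algebra.adjoin ℝ {e} := hg
    rw [Algebra.adjoin_singleton_eq_range_aeval] at hg'
    obtain ⟨p, rfl⟩ := hg'
    induction p using Polynomial.induction_on' with
    | add p q hp hq =>
      have key : ∀ (ρ : Measure NNReal) [IsFiniteMeasure ρ],
          ∫ x, (Polynomial.aeval e (p + q)) x ∂ρ
            = ∫ x, (Polynomial.aeval e p) x ∂ρ + ∫ x, (Polynomial.aeval e q) x ∂ρ := by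
        intro ρ _
        rw [← integral_add (BoundedContinuousFunction.integrable _ _)
          (BoundedContinuousFunction.integrable _ _)]
        simp
      have mem : ∀ p : Polynomial ℝ, Polynomial.aeval e p ∈ A := fun p => by
        change _ ∈ Algebra.adjoin ℝ {e}
        rw [Algebra.adjoin_singleton_eq_range_aeval]
        exact ⟨p, rfl⟩
      have hp' := hp (mem p)
      have hq' := hq (mem q)
      simp only [AlgHom.toRingHom_eq_coe, RingHom.coe_coe] at hp' hq' ⊢
      rw [key, key, hp', hq']
    | monomial n a =>
      have key : ∀ x, (Polynomial.aeval e (Polynomial.monomial n a)) x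
          = a * Real.exp (-(n * (x : ℝ))) := by
        intro x
        rw [Polynomial.aeval_monomial]
        simp [he, ← Real.exp_nat_mul, Algebra.algebraMap_eq_smul_one]
      simp only [AlgHom.toRingHom_eq_coe, RingHom.coe_coe, key, integral_const_mul, h]

/-- Two measurable functions on `(0,∞)` with equal finite Laplace transforms agree a.e. -/
theorem ae_eq_of_lintegral_exp_neg_mul_eq {g h : ℝ → ℝ≥0∞} (hg : Measurable g) (hh : Measurable h)
    (hfin : ∀ l : ℝ, 0 < l → ∫⁻ x in Ioi 0, ENNReal.ofReal (Real.exp (-(l * x))) * g x ≠ ⊤)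
    (heq : ∀ l : ℝ, 0 < l → ∫⁻ x in Ioi 0, ENNReal.ofReal (Real.exp (-(l * x))) * g x
      = ∫⁻ x in Ioi 0, ENNReal.ofReal (Real.exp (-(l * x))) * h x) :
    g =ᵐ[volume.restrict (Ioi 0)] h := by
  let E : ℝ → ℝ≥0∞ := fun x => ENNReal.ofReal (Real.exp (-x))
  have hE : Measurable E := by fun_prop
  let ρ : (ℝ → ℝ≥0∞) → Measure ℝ := fun k =>
    (volume.restrict (Ioi 0)).withDensity (fun x => E x * k x)
  have hρfin : ∀ k : ℝ → ℝ≥0∞,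
      ∫⁻ x in Ioi 0, ENNReal.ofReal (Real.exp (-(1 * x))) * k x ≠ ⊤ →
      IsFiniteMeasure (ρ k) := fun k hk => by
    refine isFiniteMeasure_withDensity (by simpa [E] using hk)
  have := hρfin g (hfin 1 one_pos)
  have := hρfin h (by rw [← heq 1 one_pos]; exact hfin 1 one_pos)
  have hlap : ∀ k : ℝ → ℝ≥0∞, Measurable k → ∀ n : ℕ,
      ∫ x : NNReal, Real.exp (-(n * (x : ℝ))) ∂((ρ k).map Real.toNNReal)
        = (∫⁻ x in Ioi 0, ENNReal.ofReal (Real.exp (-(((n : ℝ) + 1) * x))) * k x).toReal := by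
    intro k hk n
    rw [integral_map (by fun_prop) (by fun_prop),
      integral_eq_lintegral_of_nonneg_ae (Eventually.of_forall fun x => (Real.exp_pos _).le)
        (by fun_prop)]
    simp only [ρ]
    rw [lintegral_withDensity_eq_lintegral_mul _ (by fun_prop) (by fun_prop)]
    congr 1
    refine setLIntegral_congr_fun measurableSet_Ioi fun x hx => ?_
    have hx' : (0:ℝ) < x := hx
    simp only [Pi.mul_apply, E, Real.coe_toNNReal x hx'.le]
    rw [mul_right_comm, ← ENNReal.ofReal_mul (Real.exp_pos _).le, ← Real.exp_add]
    congr 3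
    ring
  have hmap : (ρ g).map Real.toNNReal = (ρ h).map Real.toNNReal := by
    refine NNReal.measure_ext_of_integral_exp_neg fun n => ?_
    rw [hlap g hg, hlap h hh, heq _ (by positivity)]
  have hback : ∀ k : ℝ → ℝ≥0∞, ((ρ k).map Real.toNNReal).map ((↑) : NNReal → ℝ) = ρ k := by
    intro k
    rw [Measure.map_map (by fun_prop) (by fun_prop)]
    conv_rhs => rw [← Measure.map_id (μ := ρ k)]
    refine Measure.map_congr ?_
    refine (withDensity_absolutelyContinuous _ _).ae_le ?_
    filter_upwards [ae_restrict_mem measurableSet_Ioi] with x hx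
    exact Real.coe_toNNReal x (le_of_lt hx)
  have hρ : ρ g = ρ h := by rw [← hback g, hmap, hback h]
  have := (withDensity_eq_iff_of_sigmaFinite (hE.mul hg).aemeasurable
    (hE.mul hh).aemeasurable).1 hρ
  filter_upwards [this] with x hx
  refine (ENNReal.mul_right_inj ?_ ?_).1 hx
  · simp [E, Real.exp_pos]
  · simp [E]

/-- The Laplace transform turns convolutions into products. -/
theorem lintegral_exp_neg_mul_conv {f g : ℝ → ℝ≥0∞} (hf : Measurable f) (hg : Measurable g)
    (l : ℝ) :
    ∫⁻ x, ENNReal.ofReal (Real.exp (-(l * x))) * ∫⁻ v, f (x - v) * g v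
      = (∫⁻ x, ENNReal.ofReal (Real.exp (-(l * x))) * f x)
        * ∫⁻ x, ENNReal.ofReal (Real.exp (-(l * x))) * g x := by
  have h1 : ∀ x, ENNReal.ofReal (Real.exp (-(l * x))) * ∫⁻ v, f (x - v) * g v
      = ∫⁻ v, (ENNReal.ofReal (Real.exp (-(l * (x - v)))) * f (x - v))
        * (ENNReal.ofReal (Real.exp (-(l * v))) * g v) := by
    intro x
    rw [← lintegral_const_mul _ (by fun_prop)]
    refine lintegral_congr fun v => ?_
    rw [mul_mul_mul_comm, ← ENNReal.ofReal_mul (Real.exp_pos _).le, ← Real.exp_add]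
    congr 4
    ring
  simp_rw [h1]
  rw [lintegral_lintegral_swap (by fun_prop), ← lintegral_const_mul _ (by fun_prop)]
  refine lintegral_congr fun v => ?_
  rw [lintegral_mul_const _ (by fun_prop)]
  congr 1
  exact lintegral_sub_right_eq_self
    (fun x => ENNReal.ofReal (Real.exp (-(l * x))) * f x) v

/-- A measure on `(0,∞)` integrating `min 1 x` is s-finite. -/
theorem sFinite_restrict_Ioi_of_lintegral_min {ν : Measure ℝ}
    (hν : ∫⁻ x in Ioi (0:ℝ), ENNReal.ofReal (min 1 x) ∂ν ≠ ⊤) :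
    SFinite (ν.restrict (Ioi (0:ℝ))) := by
  have hm : Measurable fun x : ℝ => ENNReal.ofReal (min 1 x) := by fun_prop
  have hinv := withDensity_inv_same (μ := ν.restrict (Ioi (0:ℝ))) hm
    (by filter_upwards [ae_restrict_mem measurableSet_Ioi] with x hx
        have hx' : (0:ℝ) < x := hx
        simp [hx'])
    (Eventually.of_forall fun x => ENNReal.ofReal_ne_top)
  have := isFiniteMeasure_withDensity hν
  rw [← hinv]
  infer_instance

theorem integrableOn_one_sub_exp_neg_mul {ν : Measure ℝ}
    (hν : ∫⁻ x in Ioi (0:ℝ), ENNReal.ofReal (min 1 x) ∂ν ≠ ⊤) {l : ℝ} (hl : 0 < l) :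
    IntegrableOn (fun x => 1 - Real.exp (-l * x)) (Ioi 0) ν := by
  have h1 : Integrable (fun x : ℝ => min 1 x) (ν.restrict (Ioi 0)) := by
    refine ⟨by fun_prop, ?_⟩
    rw [hasFiniteIntegral_iff_ofReal]
    · exact hν.lt_top
    · filter_upwards [ae_restrict_mem measurableSet_Ioi] with x hx
      exact le_min zero_le_one (le_of_lt hx)
  refine (h1.const_mul (max 1 l)).mono' (by fun_prop) ?_
  filter_upwards [ae_restrict_mem measurableSet_Ioi] with x hx
  have hx' : (0:ℝ) < x := hx
  have e1 : Real.exp (-l * x) ≤ 1 := Real.exp_le_one_iff.2 (by nlinarith)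
  have e2 := Real.add_one_le_exp (-l * x)
  have e3 := Real.exp_pos (-l * x)
  rw [Real.norm_of_nonneg (by linarith)]
  rcases le_total 1 x with h | h
  · rw [min_eq_left h]
    nlinarith [le_max_left 1 l]
  · rw [min_eq_right h]
    nlinarith [le_max_right 1 l]

theorem integral_one_sub_exp_neg_mul_pos {ν : Measure ℝ}
    (hν : ∫⁻ x in Ioi (0:ℝ), ENNReal.ofReal (min 1 x) ∂ν ≠ ⊤) (hν0 : ν (Ioi (0:ℝ)) ≠ 0)
    {l : ℝ} (hl : 0 < l) :
    0 < ∫ x in Ioi (0:ℝ), (1 - Real.exp (-l * x)) ∂ν := by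
  rw [setIntegral_pos_iff_support_of_nonneg_ae _ (integrableOn_one_sub_exp_neg_mul hν hl)]
  · refine (pos_iff_ne_zero.2 hν0).trans_le (measure_mono fun x hx => ⟨?_, hx⟩)
    have hx' : (0:ℝ) < x := hx
    have : Real.exp (-l * x) < 1 := Real.exp_lt_one_iff.2 (by nlinarith)
    exact (sub_pos.2 this).ne'
  · filter_upwards [ae_restrict_mem measurableSet_Ioi] with x hx
    have hx' : (0:ℝ) < x := hx
    exact sub_nonneg.2 (Real.exp_le_one_iff.2 (by nlinarith))

theorem lintegral_Ioo_exp_neg_mul {l : ℝ} (hl : 0 < l) {x : ℝ} (hx : 0 < x) :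
    ∫⁻ y in Ioo 0 x, ENNReal.ofReal (Real.exp (-(l * y)))
      = ENNReal.ofReal ((1 - Real.exp (-l * x)) / l) := by
  have hc : Continuous fun y : ℝ => Real.exp (-(l * y)) := by fun_prop
  rw [restrict_Ioo_eq_restrict_Ioc, ← ofReal_integral_eq_lintegral_ofReal
    ((hc.intervalIntegrable 0 x).1) (Eventually.of_forall fun y => (Real.exp_pos _).le),
    ← intervalIntegral.integral_of_le hx.le,
    intervalIntegral.integral_eq_sub_of_hasDerivAt
      (f := fun y => -(Real.exp (-(l * y)) / l)) _ (hc.intervalIntegrable 0 x)]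
  · congr 1
    simp only [mul_zero, neg_zero, Real.exp_zero, neg_mul]
    ring
  · intro y _
    have h1 : HasDerivAt (fun y : ℝ => -(l * y)) (-l) y := by
      simpa using ((hasDerivAt_id y).const_mul l).fun_neg
    have h2 := (h1.exp.div_const l).fun_neg
    convert h2 using 1
    field_simp

/-- Laplace transform of the tail of a Lévy measure. -/
theorem lintegral_exp_neg_mul_tail {ν : Measure ℝ}
    (hν : ∫⁻ x in Ioi (0:ℝ), ENNReal.ofReal (min 1 x) ∂ν ≠ ⊤) {l : ℝ} (hl : 0 < l) :
    ∫⁻ y in Ioi 0, ENNReal.ofReal (Real.exp (-(l * y))) * ν (Ioi y)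
      = ENNReal.ofReal ((∫ x in Ioi (0:ℝ), (1 - Real.exp (-l * x)) ∂ν) / l) := by
  have := sFinite_restrict_Ioi_of_lintegral_min hν
  have hm : Measurable (Function.uncurry fun y x : ℝ =>
      ENNReal.ofReal (Real.exp (-(l * y))) * (Iio x).indicator (fun _ => (1 : ℝ≥0∞)) y) := by
    refine Measurable.mul (by fun_prop) ?_
    have : (fun p : ℝ × ℝ => (Iio p.2).indicator (fun _ => (1 : ℝ≥0∞)) p.1)
        = {p : ℝ × ℝ | p.1 < p.2}.indicator (fun _ => 1) := by
      ext p; simp [indicator_apply]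
    rw [this]
    exact measurable_const.indicator (measurableSet_lt measurable_fst measurable_snd)
  have h1 : ∫⁻ y in Ioi 0, ENNReal.ofReal (Real.exp (-(l * y))) * ν (Ioi y)
      = ∫⁻ y in Ioi 0, ∫⁻ x in Ioi (0:ℝ),
        ENNReal.ofReal (Real.exp (-(l * y))) * (Iio x).indicator (fun _ => (1 : ℝ≥0∞)) y ∂ν := by
    refine setLIntegral_congr_fun measurableSet_Ioi fun y hy => ?_
    have hy' : (0:ℝ) < y := hy
    rw [lintegral_const_mul _ (by
      have : (fun x : ℝ => (Iio x).indicator (fun _ => (1 : ℝ≥0∞)) y)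
        = (Ioi y).indicator (fun _ => 1) := by ext x; simp [indicator_apply]
      rw [this]
      exact measurable_const.indicator measurableSet_Ioi)]
    congr 1
    have : (fun x : ℝ => (Iio x).indicator (fun _ => (1 : ℝ≥0∞)) y)
        = (Ioi y).indicator (fun _ => 1) := by ext x; simp [indicator_apply]
    rw [this, lintegral_indicator measurableSet_Ioi, setLIntegral_one,
      Measure.restrict_apply measurableSet_Ioi,
      inter_eq_left.2 (Ioi_subset_Ioi hy'.le)]
  rw [h1, lintegral_lintegral_swap hm.aemeasurable, ← integral_div,
    ofReal_integral_eq_lintegral_ofReal ((integrableOn_one_sub_exp_neg_mul hν hl).div_const l)]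
  · refine setLIntegral_congr_fun measurableSet_Ioi fun x hx => ?_
    have hx' : (0:ℝ) < x := hx
    rw [← lintegral_Ioo_exp_neg_mul hl hx', ← Ioi_inter_Iio, inter_comm,
      ← Measure.restrict_restrict measurableSet_Iio, ← lintegral_indicator measurableSet_Iio]
    refine lintegral_congr fun y => ?_
    simp [indicator_apply]
  · filter_upwards [ae_restrict_mem measurableSet_Ioi] with x hx
    have hx' : (0:ℝ) < x := hx
    exact div_nonneg (sub_nonneg.2 (Real.exp_le_one_iff.2 (by nlinarith))) hl.le

/-- Laplace transform of a measure on `[0,∞)` given by a density. -/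
theorem lintegral_exp_neg_mul_density {m : Measure ℝ} [IsFiniteMeasure m] {p : ℝ → ℝ}
    (hp : Measurable p)
    (hdens : ∀ A : Set ℝ, MeasurableSet A → m A = ∫⁻ t in A ∩ Ici 0, ENNReal.ofReal (p t))
    {l : ℝ} (hl : 0 < l) :
    ∫⁻ v in Ioi 0, ENNReal.ofReal (Real.exp (-(l * v))) * ENNReal.ofReal (p v)
      = ENNReal.ofReal (∫ s, Real.exp (-l * s) ∂m) := by
  have hm : m = (volume.restrict (Ici 0)).withDensity fun t => ENNReal.ofReal (p t) := by
    ext A hA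
    rw [hdens A hA, withDensity_apply _ hA, Measure.restrict_restrict hA]
  have h0 : ∀ᵐ s ∂m, 0 ≤ s := by
    rw [hm]
    exact (withDensity_absolutelyContinuous _ _).ae_le (ae_restrict_mem measurableSet_Ici)
  rw [ofReal_integral_eq_lintegral_ofReal _
    (Eventually.of_forall fun y => (Real.exp_pos _).le)]
  · conv_rhs => rw [hm]
    rw [lintegral_withDensity_eq_lintegral_mul _ (by fun_prop) (by fun_prop),
      restrict_Ioi_eq_restrict_Ici]
    refine lintegral_congr fun v => ?_
    simp [mul_comm]
  · refine (integrable_const (1:ℝ)).mono' (by fun_prop) ?_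
    filter_upwards [h0] with s hs
    rw [Real.norm_eq_abs, Real.abs_exp]
    exact Real.exp_le_one_iff.2 (by nlinarith)

/-- Laplace transform of the potential density `∫₀^∞ p(r,·) dr` of a subordinator. -/
theorem lintegral_exp_neg_mul_potential {m : ℝ → Measure ℝ}
    (hprob : ∀ r : ℝ, 0 < r → IsProbabilityMeasure (m r)) {φ : ℝ → ℝ}
    (hlap : ∀ r : ℝ, 0 < r → ∀ l : ℝ, 0 < l →
      ∫ s, Real.exp (-l * s) ∂(m r) = Real.exp (-r * φ l))
    {p : ℝ → ℝ → ℝ} (hp : Measurable (Function.uncurry p))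
    (hdens : ∀ r : ℝ, 0 < r → ∀ A : Set ℝ, MeasurableSet A →
      m r A = ∫⁻ t in A ∩ Set.Ici 0, ENNReal.ofReal (p r t))
    {l : ℝ} (hl : 0 < l) (hφ : 0 < φ l) :
    ∫⁻ v in Ioi 0, ENNReal.ofReal (Real.exp (-(l * v)))
        * ∫⁻ r in Ioi (0:ℝ), ENNReal.ofReal (p r v)
      = ENNReal.ofReal (1 / φ l) := by
  have hpm : Measurable fun z : ℝ × ℝ => ENNReal.ofReal (p z.2 z.1) :=
    (hp.comp measurable_swap).ennreal_ofReal
  have h1 : ∀ v, ENNReal.ofReal (Real.exp (-(l * v)))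
        * ∫⁻ r in Ioi (0:ℝ), ENNReal.ofReal (p r v)
      = ∫⁻ r in Ioi (0:ℝ), ENNReal.ofReal (Real.exp (-(l * v))) * ENNReal.ofReal (p r v) :=
    fun v => (lintegral_const_mul _ (hpm.comp measurable_prodMk_left)).symm
  simp_rw [h1]
  rw [lintegral_lintegral_swap]
  · have h2 : ∫⁻ r in Ioi (0:ℝ), ∫⁻ v in Ioi 0,
          ENNReal.ofReal (Real.exp (-(l * v))) * ENNReal.ofReal (p r v)
        = ∫⁻ r in Ioi (0:ℝ), ENNReal.ofReal (Real.exp (-φ l * r)) := by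
      refine setLIntegral_congr_fun measurableSet_Ioi fun r hr => ?_
      have := hprob r hr
      rw [lintegral_exp_neg_mul_density (p := p r) (hp.comp measurable_prodMk_left) (hdens r hr) hl,
        hlap r hr l hl]
      congr 2
      ring
    rw [h2, ← ofReal_integral_eq_lintegral_ofReal
      (integrableOn_exp_mul_Ioi (neg_lt_zero.2 hφ) 0)
      (Eventually.of_forall fun y => (Real.exp_pos _).le),
      integral_exp_mul_Ioi (neg_lt_zero.2 hφ)]
    congr 1
    simp
  · refine Measurable.aemeasurable (Measurable.mul (by fun_prop) hpm)

theorem measurable_potential {p : ℝ → ℝ → ℝ} (hp : Measurable (Function.uncurry p)) :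
    Measurable fun v => ∫⁻ r in Ioi (0:ℝ), ENNReal.ofReal (p r v) :=
  Measurable.lintegral_prod_right' (f := fun z : ℝ × ℝ => ENNReal.ofReal (p z.2 z.1))
    (hp.comp measurable_swap).ennreal_ofReal

/-- The tail of the Lévy measure convolved with the potential density equals `1` a.e. when their
Laplace transforms multiply to `1 / l`. -/
theorem tail_conv_potential_ae_eq_one {W U : ℝ → ℝ≥0∞} (hW : Measurable W) (hU : Measurable U)
    {φ : ℝ → ℝ} (hφ : ∀ l, 0 < l → 0 < φ l)
    (hWl : ∀ l : ℝ, 0 < l → ∫⁻ y in Ioi 0, ENNReal.ofReal (Real.exp (-(l * y))) * W y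
      = ENNReal.ofReal (φ l / l))
    (hUl : ∀ l : ℝ, 0 < l → ∫⁻ y in Ioi 0, ENNReal.ofReal (Real.exp (-(l * y))) * U y
      = ENNReal.ofReal (1 / φ l)) :
    ∀ᵐ x ∂(volume.restrict (Ioi (0:ℝ))), ∫⁻ v in Ioc 0 x, W (x - v) * U v = 1 := by
  have hW' : Measurable ((Ioi (0:ℝ)).indicator W) := hW.indicator measurableSet_Ioi
  have hU' : Measurable ((Ioi (0:ℝ)).indicator U) := hU.indicator measurableSet_Ioi
  have hconv : ∀ x, ∫⁻ v, (Ioi (0:ℝ)).indicator W (x - v) * (Ioi (0:ℝ)).indicator U v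
      = ∫⁻ v in Ioc 0 x, W (x - v) * U v := by
    intro x
    rw [← restrict_Ioo_eq_restrict_Ioc, ← lintegral_indicator measurableSet_Ioo]
    refine lintegral_congr fun v => ?_
    by_cases h1 : 0 < v <;> by_cases h2 : v < x <;> simp [h1, h2]
  have hind : ∀ (k : ℝ → ℝ≥0∞) (l : ℝ),
      ∫⁻ x, ENNReal.ofReal (Real.exp (-(l * x))) * (Ioi (0:ℝ)).indicator k x
        = ∫⁻ x in Ioi 0, ENNReal.ofReal (Real.exp (-(l * x))) * k x := by
    intro k l
    rw [← lintegral_indicator measurableSet_Ioi]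
    refine lintegral_congr fun v => ?_
    simp [indicator_apply]
  have hC : Measurable fun x => ∫⁻ v in Ioc 0 x, W (x - v) * U v := by
    simp_rw [← hconv]
    fun_prop
  have hClap : ∀ l : ℝ, 0 < l →
      ∫⁻ x in Ioi 0, ENNReal.ofReal (Real.exp (-(l * x))) * ∫⁻ v in Ioc 0 x, W (x - v) * U v
        = ENNReal.ofReal (1 / l) := by
    intro l hl
    have h1 := lintegral_exp_neg_mul_conv hW' hU' l
    rw [hind, hind, hWl l hl, hUl l hl, ← ENNReal.ofReal_mul (div_pos (hφ l hl) hl).le] at h1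
    have h2 : φ l / l * (1 / φ l) = 1 / l := by
      have := (hφ l hl).ne'
      field_simp
    rw [← h2, ← h1, ← hind]
    refine lintegral_congr fun x => ?_
    rw [hconv]
    by_cases hx : 0 < x
    · simp [hx]
    · simp [hx]
  have hone : ∀ l : ℝ, 0 < l →
      ∫⁻ x in Ioi 0, ENNReal.ofReal (Real.exp (-(l * x))) * (1 : ℝ≥0∞)
        = ENNReal.ofReal (1 / l) := by
    intro l hl
    simp only [mul_one]
    simp_rw [← neg_mul]
    rw [← ofReal_integral_eq_lintegral_ofReal
      (integrableOn_exp_mul_Ioi (neg_lt_zero.2 hl) 0)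
      (Eventually.of_forall fun y => (Real.exp_pos _).le),
      integral_exp_mul_Ioi (neg_lt_zero.2 hl)]
    congr 1
    simp
  exact ae_eq_of_lintegral_exp_neg_mul_eq hC measurable_const
    (fun l hl => by rw [hClap l hl]; exact ENNReal.ofReal_ne_top)
    (fun l hl => by rw [hClap l hl, hone l hl])

theorem setLIntegral_Ioc_ne_top_of_laplace {U : ℝ → ℝ≥0∞}
    (h : ∫⁻ y in Ioi 0, ENNReal.ofReal (Real.exp (-(1 * y))) * U y ≠ ⊤) (T : ℝ) :
    ∫⁻ v in Ioc 0 T, U v ≠ ⊤ := by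
  have h1 : ∫⁻ v in Ioc 0 T, U v ≤ ENNReal.ofReal (Real.exp T)
      * ∫⁻ y in Ioi 0, ENNReal.ofReal (Real.exp (-(1 * y))) * U y := by
    rw [← lintegral_const_mul' _ _ ENNReal.ofReal_ne_top]
    refine (setLIntegral_mono' measurableSet_Ioc fun v hv => ?_).trans
      (lintegral_mono_set Ioc_subset_Ioi_self)
    rw [← mul_assoc, ← ENNReal.ofReal_mul (Real.exp_pos _).le, ← Real.exp_add]
    refine le_mul_of_one_le_left' ?_
    rw [← ENNReal.ofReal_one]
    exact ENNReal.ofReal_le_ofReal (Real.one_le_exp (by linarith [hv.2]))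
  exact ne_top_of_le_ne_top (ENNReal.mul_ne_top ENNReal.ofReal_ne_top h) h1

section PotentialIntegrand

variable {𝔹 : Type*} [NormedAddCommGroup 𝔹] [NormedSpace ℝ 𝔹]

/-- The integrand `(t, s, r) ↦ κ(t) p(r, t - s) G(r, s)` on the region `s < t`. -/
noncomputable def potentialIntegrand (p : ℝ → ℝ → ℝ) (κ : ℝ → ℝ) (G : ℝ → ℝ → 𝔹) :
    ℝ × ℝ × ℝ → 𝔹 :=
  {z | z.2.1 < z.1}.indicator fun z => (κ z.1 * p z.2.2 (z.1 - z.2.1)) • G z.2.2 z.2.1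

variable {p : ℝ → ℝ → ℝ} {κ : ℝ → ℝ} {G : ℝ → ℝ → 𝔹}

theorem potentialIntegrand_of_lt {t s : ℝ} (h : s < t) (r : ℝ) :
    potentialIntegrand p κ G (t, s, r) = (κ t * p r (t - s)) • G r s :=
  indicator_of_mem (show (t, s, r) ∈ {z : ℝ × ℝ × ℝ | z.2.1 < z.1} from h) _

theorem potentialIntegrand_of_le {t s : ℝ} (h : t ≤ s) (r : ℝ) :
    potentialIntegrand p κ G (t, s, r) = 0 :=
  indicator_of_notMem (show (t, s, r) ∉ {z : ℝ × ℝ × ℝ | z.2.1 < z.1} from h.not_gt) _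

theorem stronglyMeasurable_potentialIntegrand (hp : Measurable (Function.uncurry p))
    (hκ : Measurable κ) (hG : StronglyMeasurable (Function.uncurry G)) :
    StronglyMeasurable (potentialIntegrand p κ G) := by
  refine StronglyMeasurable.indicator ?_
    (measurableSet_lt (measurable_fst.comp measurable_snd) measurable_fst)
  have h1 : Measurable fun z : ℝ × ℝ × ℝ => κ z.1 * p z.2.2 (z.1 - z.2.1) :=
    (hκ.comp measurable_fst).mul (hp.comp (f := fun z : ℝ × ℝ × ℝ => (z.2.2, z.1 - z.2.1))
      (by fun_prop))
  exact h1.stronglyMeasurable.smul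
    (hG.comp_measurable (g := fun z : ℝ × ℝ × ℝ => (z.2.2, z.2.1)) (by fun_prop))

theorem lintegral_enorm_potentialIntegrand_slice_le (hp : Measurable (Function.uncurry p))
    (hp0 : ∀ r t, 0 ≤ p r t) (hκ : Measurable κ) (hκ0 : ∀ t, 0 ≤ κ t)
    {s T : ℝ} {b : ℝ≥0∞} (hb : ∀ r, ‖G r s‖ₑ ≤ b) :
    ∫⁻ r in Ioi (0:ℝ), ∫⁻ t in Ioc 0 T, ‖potentialIntegrand p κ G (t, s, r)‖ₑ
      ≤ b * ∫⁻ v in Ioc 0 (T - s), ENNReal.ofReal (κ (s + v))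
          * ∫⁻ r in Ioi (0:ℝ), ENNReal.ofReal (p r v) := by
  have hpm : Measurable fun z : ℝ × ℝ => ENNReal.ofReal (p z.2 z.1) :=
    (hp.comp measurable_swap).ennreal_ofReal
  have h1 : ∀ r, ∫⁻ t in Ioc 0 T, ‖potentialIntegrand p κ G (t, s, r)‖ₑ
      ≤ b * ∫⁻ v in Ioc 0 (T - s), ENNReal.ofReal (κ (s + v)) * ENNReal.ofReal (p r v) := by
    intro r
    have hm : Measurable fun v =>
        ENNReal.ofReal (κ (s + v)) * ENNReal.ofReal (p r v) :=
      (hκ.comp (measurable_const_add s)).ennreal_ofReal.mul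
        (hpm.comp measurable_prodMk_right)
    rw [← lintegral_indicator measurableSet_Ioc, ← lintegral_indicator measurableSet_Ioc,
      ← lintegral_const_mul _ (hm.indicator measurableSet_Ioc),
      ← lintegral_add_left_eq_self _ s]
    refine lintegral_mono fun v => ?_
    by_cases hv : s + v ∈ Ioc 0 T
    · by_cases hv0 : 0 < v
      · have hv' : v ∈ Ioc 0 (T - s) := ⟨hv0, by linarith [hv.2]⟩
        rw [indicator_of_mem hv, indicator_of_mem hv',
          potentialIntegrand_of_lt (by linarith)]
        simp only [enorm_smul, add_sub_cancel_left]
        rw [Real.enorm_of_nonneg (mul_nonneg (hκ0 _) (hp0 _ _)), ENNReal.ofReal_mul (hκ0 _),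
          mul_comm]
        gcongr
        exact hb r
      · rw [indicator_of_mem hv, potentialIntegrand_of_le (by linarith)]
        simp
    · simp [indicator_of_notMem hv]
  refine (lintegral_mono h1).trans_eq ?_
  have hm2 : Measurable fun z : ℝ × ℝ =>
      ENNReal.ofReal (κ (s + z.1)) * ENNReal.ofReal (p z.2 z.1) :=
    (hκ.comp (f := fun z : ℝ × ℝ => s + z.1) (by fun_prop)).ennreal_ofReal.mul hpm
  have hm3 : Measurable fun r => ∫⁻ v in Ioc 0 (T - s),
      ENNReal.ofReal (κ (s + v)) * ENNReal.ofReal (p r v) :=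
    (hm2.comp measurable_swap).lintegral_prod_right'
  rw [lintegral_const_mul _ hm3,
    lintegral_lintegral_swap
      (f := fun r v => ENNReal.ofReal (κ (s + v)) * ENNReal.ofReal (p r v))
      (hm2.comp measurable_swap).aemeasurable]
  congr 1
  refine lintegral_congr fun v => ?_
  exact lintegral_const_mul _ (hpm.comp measurable_prodMk_left)

theorem lintegral_enorm_potentialIntegrand_le (hp : Measurable (Function.uncurry p))
    (hp0 : ∀ r t, 0 ≤ p r t) (hκ : Measurable κ) (hκ0 : ∀ t, 0 ≤ κ t)
    (hG : StronglyMeasurable (Function.uncurry G)) {b : ℝ → ℝ≥0∞} (hbm : Measurable b)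
    (hb : ∀ r s, ‖G r s‖ₑ ≤ b s) {T : ℝ} {B : ℝ≥0∞}
    (hB : ∀ᵐ s ∂(volume.restrict (Ioc 0 T)), ∫⁻ v in Ioc 0 (T - s), ENNReal.ofReal (κ (s + v))
          * ∫⁻ r in Ioi (0:ℝ), ENNReal.ofReal (p r v) ≤ B) :
    ∫⁻ z, ‖potentialIntegrand p κ G z‖ₑ ∂((volume.restrict (Ioc 0 T)).prod
        ((volume.restrict (Ioc 0 T)).prod (volume.restrict (Ioi (0:ℝ)))))
      ≤ B * ∫⁻ s in Ioc 0 T, b s := by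
  have hm := (stronglyMeasurable_potentialIntegrand hp hκ hG).enorm
  rw [lintegral_prod_symm' _ hm, lintegral_prod _ (Measurable.lintegral_prod_left' hm).aemeasurable,
    ← lintegral_const_mul _ hbm]
  refine lintegral_mono_ae ?_
  filter_upwards [hB] with s hs
  refine (lintegral_enorm_potentialIntegrand_slice_le hp hp0 hκ hκ0
    (fun r => hb r s)).trans ?_
  rw [mul_comm]
  gcongr

theorem restrict_Ioc_prod_Ioi_restrict_lt {t T : ℝ} (ht : t ∈ Ioc 0 T) :
    ((volume.restrict (Ioc 0 T)).prod (volume.restrict (Ioi (0:ℝ)))).restrict {q | q.1 < t}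
      = (volume : Measure (ℝ × ℝ)).restrict (Ioc 0 t ×ˢ Ioi 0) := by
  have h1 : {q : ℝ × ℝ | q.1 < t} = Iio t ×ˢ univ := by ext; simp
  rw [h1, ← Measure.prod_restrict, Measure.restrict_univ,
    Measure.restrict_restrict measurableSet_Iio]
  have h2 : Iio t ∩ Ioc 0 T = Ioo 0 t := by
    ext x; simp only [mem_inter_iff, mem_Iio, mem_Ioc, mem_Ioo]
    exact ⟨fun h => ⟨h.2.1, h.1⟩, fun h => ⟨h.2, h.1, (h.2.trans_le ht.2).le⟩⟩
  rw [h2, restrict_Ioo_eq_restrict_Ioc, Measure.prod_restrict]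
  rfl

theorem potentialIntegrand_slice (t : ℝ) :
    (fun q : ℝ × ℝ => potentialIntegrand p κ G (t, q))
      = {q : ℝ × ℝ | q.1 < t}.indicator
          (fun q => κ t • p q.2 (t - q.1) • G q.2 q.1) := by
  ext q
  by_cases h : q.1 < t <;> simp [potentialIntegrand, h, mul_smul]

theorem integral_potentialIntegrand_slice {t T : ℝ} (ht : t ∈ Ioc 0 T) :
    ∫ q, potentialIntegrand p κ G (t, q)
        ∂((volume.restrict (Ioc 0 T)).prod (volume.restrict (Ioi (0:ℝ))))
      = κ t • ∫ q in Ioc 0 t ×ˢ Ioi (0:ℝ), p q.2 (t - q.1) • G q.2 q.1 := by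
  rw [potentialIntegrand_slice, integral_indicator (measurableSet_lt measurable_fst
    measurable_const), restrict_Ioc_prod_Ioi_restrict_lt ht, integral_smul]

theorem integrableOn_of_integrable_potentialIntegrand_slice {t T : ℝ} (ht : t ∈ Ioc 0 T)
    (h : Integrable (fun q => potentialIntegrand p (fun _ => 1) G (t, q))
      ((volume.restrict (Ioc 0 T)).prod (volume.restrict (Ioi (0:ℝ))))) :
    IntegrableOn (fun q : ℝ × ℝ => p q.2 (t - q.1) • G q.2 q.1) (Ioc 0 t ×ˢ Ioi (0:ℝ)) := by
  rw [potentialIntegrand_slice, integrable_indicator_iff (measurableSet_lt measurable_fst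
    measurable_const), IntegrableOn, restrict_Ioc_prod_Ioi_restrict_lt ht] at h
  simp only [one_smul] at h
  exact h

theorem integral_potentialIntegrand_time [CompleteSpace 𝔹] {s T : ℝ} (hs : s ∈ Ioc 0 T) (r : ℝ) :
    ∫ t in Ioc 0 T, potentialIntegrand p κ G (t, s, r)
      = (∫ v in Ioc 0 (T - s), κ (s + v) * p r v) • G r s := by
  rw [← integral_smul_const, ← integral_indicator measurableSet_Ioc,
    ← integral_indicator measurableSet_Ioc, ← integral_add_left_eq_self _ s]
  congr 1
  ext v
  by_cases hv0 : 0 < v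
  · by_cases hv : v ≤ T - s
    · rw [indicator_of_mem (show s + v ∈ Ioc 0 T from ⟨by linarith [hs.1], by linarith⟩),
        indicator_of_mem (show v ∈ Ioc 0 (T - s) from ⟨hv0, hv⟩),
        potentialIntegrand_of_lt (by linarith)]
      simp
    · rw [indicator_of_notMem (fun h => hv (by linarith [h.2])),
        indicator_of_notMem (fun h => hv h.2)]
  · rw [indicator_of_notMem (s := Ioc 0 (T - s)) (fun h => hv0 h.1)]
    simp [indicator_apply, potentialIntegrand_of_le (show s + v ≤ s by linarith)]

end PotentialIntegrand

/-- Joint measurability of `(r, s) ↦ P_r (f s)` for a strongly continuous family `P` on `[0,∞)`. -/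
theorem stronglyMeasurable_uncurry_apply_max {𝔹 : Type*} [NormedAddCommGroup 𝔹] [NormedSpace ℝ 𝔹]
    {P : ℝ → 𝔹 →L[ℝ] 𝔹} (hP : ∀ g : 𝔹, ContinuousOn (fun t => P t g) (Ici (0:ℝ)))
    {f : ℝ → 𝔹} (hf : StronglyMeasurable f) :
    StronglyMeasurable (Function.uncurry fun r s => P (max r 0) (f s)) :=
  stronglyMeasurable_uncurry_of_continuous_of_stronglyMeasurable
    (fun s => (hP (f s)).comp_continuous (by fun_prop) fun r => le_max_right r 0)
    (fun r => (P (max r 0)).continuous.comp_stronglyMeasurable hf)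

theorem ae_restrict_Ioc_sub_left {q : ℝ → Prop} (h : ∀ᵐ x ∂(volume.restrict (Ioi (0:ℝ))), q x)
    (h0 : q 0) (T : ℝ) : ∀ᵐ s ∂(volume.restrict (Ioc 0 T)), q (T - s) := by
  rw [ae_restrict_iff' measurableSet_Ioi] at h
  have := (Measure.measurePreserving_sub_left volume T).quasiMeasurePreserving.ae h
  filter_upwards [ae_restrict_of_ae this, ae_restrict_mem measurableSet_Ioc] with s hs hs'
  rcases hs'.2.lt_or_eq with h | h
  · exact hs (sub_pos.2 h)
  · rwa [h, sub_self]

/-- Proposition 2.3(i).  For a strongly measurable `f : (0,T₀] → 𝔹` with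
`∫₀^{T₀} ‖f(t)‖ dt < ∞`, the function
`u(t) = ∫₀^t ∫₀^∞ P⁰_r f(s) p̄(r,t−s) dr ds` is well defined as a Bochner integral for a.e.
`t ∈ (0,T₀]` and `∫₀^{T₀} ‖u(t)‖ dt < ∞`; moreover for every `T ∈ (0,T₀]`,
`∫₀^T w(T−t) ‖u(t)‖ dt ≤ M ∫₀^T ‖f(s)‖ ds` and
`∫₀^T w(T−t) u(t) dt = ∫₀^T ∫₀^∞ P⁰_r f(s) (∫₀^{T−s} w(T−s−v) p̄(r,v) dv) dr ds` in `𝔹`. -/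
theorem time_frac_stmt1
    {𝔹 : Type*} [NormedAddCommGroup 𝔹] [NormedSpace ℝ 𝔹] [CompleteSpace 𝔹]
    (ν : Measure ℝ)
    (hν_loc : ∫⁻ x in Set.Ioi (0:ℝ), ENNReal.ofReal (min 1 x) ∂ν ≠ ⊤)
    (hν_inf : ν (Set.Ioi (0:ℝ)) = ⊤)
    (φ : ℝ → ℝ)
    (hφ : ∀ l : ℝ, 0 < l → φ l = ∫ x in Set.Ioi (0:ℝ), (1 - Real.exp (-l * x)) ∂ν)
    (w : ℝ → ℝ)
    (hw : ∀ x : ℝ, w x = (ν (Set.Ioi x)).toReal)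
    (μr : ℝ → Measure ℝ)
    (hprob : ∀ r : ℝ, 0 < r → IsProbabilityMeasure (μr r))
    (hlap : ∀ r : ℝ, 0 < r → ∀ l : ℝ, 0 < l →
      ∫ s, Real.exp (-l * s) ∂(μr r) = Real.exp (-r * φ l))
    (pbar : ℝ → ℝ → ℝ)
    (hpbar_nn : ∀ r t : ℝ, 0 ≤ pbar r t)
    (hpbar_meas : Measurable (Function.uncurry pbar))
    (hpbar_bdd : ∀ r : ℝ, 0 < r → ∃ C : ℝ, ∀ t : ℝ, pbar r t ≤ C)
    (hdens : ∀ r : ℝ, 0 < r → ∀ A : Set ℝ, MeasurableSet A →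
      μr r A = ∫⁻ t in A ∩ Set.Ici 0, ENNReal.ofReal (pbar r t))
    -- uniformly bounded strongly continuous semigroup on 𝔹
    (P : ℝ → 𝔹 →L[ℝ] 𝔹)
    (hP0 : P 0 = ContinuousLinearMap.id ℝ 𝔹)
    (hPsemi : ∀ s t : ℝ, 0 ≤ s → 0 ≤ t → P (s + t) = (P s).comp (P t))
    (M : ℝ) (hM : ∀ t : ℝ, 0 ≤ t → ‖P t‖ ≤ M)
    (hPcont : ∀ g : 𝔹, ContinuousOn (fun t => P t g) (Set.Ici (0:ℝ)))
    -- the data f and the candidate solution u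
    (T₀ : ℝ) (hT₀ : 0 < T₀)
    (f : ℝ → 𝔹)
    (hf_int : IntegrableOn f (Set.Ioc 0 T₀))
    (u : ℝ → 𝔹)
    (hu : ∀ t : ℝ, u t =
      ∫ s in Set.Ioc (0:ℝ) t, ∫ r in Set.Ioi (0:ℝ), pbar r (t - s) • P r (f s)) :
    (∀ᵐ t ∂(volume.restrict (Set.Ioc (0:ℝ) T₀)),
      IntegrableOn (fun p : ℝ × ℝ => pbar p.2 (t - p.1) • P p.2 (f p.1))
        ((Set.Ioc (0:ℝ) t) ×ˢ (Set.Ioi (0:ℝ)))) ∧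
    IntegrableOn u (Set.Ioc 0 T₀) ∧
    (∀ T ∈ Set.Ioc (0:ℝ) T₀,
      (∫⁻ t in Set.Ioc (0:ℝ) T, ENNReal.ofReal (w (T - t) * ‖u t‖)
          ≤ ENNReal.ofReal (M * ∫ s in Set.Ioc (0:ℝ) T, ‖f s‖)) ∧
      (∫ t in Set.Ioc (0:ℝ) T, w (T - t) • u t)
        = ∫ s in Set.Ioc (0:ℝ) T, ∫ r in Set.Ioi (0:ℝ),
            (∫ v in Set.Ioc (0:ℝ) (T - s), w (T - s - v) * pbar r v) • P r (f s)) := by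
  have hM0 : 0 ≤ M := (norm_nonneg _).trans (hM 0 le_rfl)
  have hφpos : ∀ l, 0 < l → 0 < φ l := fun l hl => by
    rw [hφ l hl]
    exact integral_one_sub_exp_neg_mul_pos hν_loc (by simp [hν_inf]) hl
  set U : ℝ → ℝ≥0∞ := fun v => ∫⁻ r in Ioi (0:ℝ), ENNReal.ofReal (pbar r v) with hU
  have hUm : Measurable U := measurable_potential hpbar_meas
  have hUl : ∀ l : ℝ, 0 < l → ∫⁻ y in Ioi 0, ENNReal.ofReal (Real.exp (-(l * y))) * U y
      = ENNReal.ofReal (1 / φ l) := fun l hl =>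
    lintegral_exp_neg_mul_potential hprob hlap hpbar_meas hdens hl (hφpos l hl)
  have hUfin : ∀ T, ∫⁻ v in Ioc 0 T, U v ≠ ⊤ :=
    setLIntegral_Ioc_ne_top_of_laplace (by rw [hUl 1 one_pos]; exact ENNReal.ofReal_ne_top)
  have hWm : Measurable fun y : ℝ => ν (Ioi y) :=
    (show Antitone fun y : ℝ => ν (Ioi y) from
      fun a b hab => measure_mono (Ioi_subset_Ioi hab)).measurable
  have hconv := tail_conv_potential_ae_eq_one hWm hUm hφpos
    (fun l hl => by rw [lintegral_exp_neg_mul_tail hν_loc hl, hφ l hl]) hUl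
  have hwm : Measurable w := by
    rw [funext hw]
    exact hWm.ennreal_toReal
  have hw0 : ∀ x, 0 ≤ w x := fun x => by rw [hw]; exact ENNReal.toReal_nonneg
  have hwconv : ∀ T, ∀ᵐ s ∂(volume.restrict (Ioc 0 T)),
      ∫⁻ v in Ioc 0 (T - s), ENNReal.ofReal (w (T - (s + v))) * U v ≤ 1 := by
    intro T
    have h1 : ∀ᵐ x ∂(volume.restrict (Ioi (0:ℝ))), ∫⁻ v in Ioc 0 x, ν (Ioi (x - v)) * U v ≤ 1 :=
      hconv.mono fun x hx => hx.le
    refine (ae_restrict_Ioc_sub_left h1 (by simp) T).mono fun s hs => ?_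
    refine (lintegral_mono fun v => ?_).trans hs
    rw [hw, sub_add_eq_sub_sub]
    gcongr
    exact ENNReal.ofReal_toReal_le
  obtain ⟨f', hf'm, hff'⟩ := hf_int.1
  set G : ℝ → ℝ → 𝔹 := fun r s => P (max r 0) (f' s) with hGdef
  have hGm : StronglyMeasurable (Function.uncurry G) :=
    stronglyMeasurable_uncurry_apply_max hPcont hf'm
  have hGb : ∀ r s, ‖G r s‖ₑ ≤ ENNReal.ofReal M * ‖f' s‖ₑ := by
    intro r s
    rw [← ofReal_norm, ← ofReal_norm, ← ENNReal.ofReal_mul hM0]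
    exact ENNReal.ofReal_le_ofReal (((P (max r 0)).le_opNorm _).trans
      (mul_le_mul_of_nonneg_right (hM _ (le_max_right r 0)) (norm_nonneg _)))
  have hbm : Measurable fun s => ENNReal.ofReal M * ‖f' s‖ₑ := hf'm.enorm.const_mul _
  have hff'T : ∀ T ≤ T₀, f =ᵐ[volume.restrict (Ioc 0 T)] f' := fun T hT =>
    ae_restrict_of_ae_restrict_of_subset (Ioc_subset_Ioc_right hT) hff'
  have hfT : ∀ T ≤ T₀, ∫⁻ s in Ioc 0 T, ENNReal.ofReal M * ‖f' s‖ₑ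
      = ENNReal.ofReal (M * ∫ s in Ioc (0:ℝ) T, ‖f s‖) := by
    intro T hT
    rw [lintegral_const_mul _ hf'm.enorm, ENNReal.ofReal_mul hM0,
      ofReal_integral_norm_eq_lintegral_enorm (hf_int.mono_set (Ioc_subset_Ioc_right hT))]
    congr 1
    refine lintegral_congr_ae ?_
    filter_upwards [hff'T T hT] with s hs
    rw [hs]
  have hΦint : ∀ T ≤ T₀, ∀ κ : ℝ → ℝ, Measurable κ → (∀ t, 0 ≤ κ t) → ∀ B : ℝ≥0∞, B ≠ ⊤ →
      (∀ᵐ s ∂(volume.restrict (Ioc 0 T)),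
        ∫⁻ v in Ioc 0 (T - s), ENNReal.ofReal (κ (s + v)) * U v ≤ B) →
      Integrable (potentialIntegrand pbar κ G) ((volume.restrict (Ioc 0 T)).prod
        ((volume.restrict (Ioc 0 T)).prod (volume.restrict (Ioi (0:ℝ))))) := by
    intro T hT κ hκ hκ0 B hBtop hB
    refine ⟨(stronglyMeasurable_potentialIntegrand hpbar_meas hκ hGm).aestronglyMeasurable, ?_⟩
    refine (lintegral_enorm_potentialIntegrand_le hpbar_meas hpbar_nn hκ hκ0 hGm hbm hGb
      hB).trans_lt ?_
    rw [hfT T hT]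
    exact ENNReal.mul_lt_top hBtop.lt_top ENNReal.ofReal_lt_top
  have hint1 := hΦint T₀ le_rfl (fun _ => 1) measurable_const (fun _ => zero_le_one) _ (hUfin T₀)
    (by
      filter_upwards [ae_restrict_mem measurableSet_Ioc] with s hs
      simp only [ENNReal.ofReal_one, one_mul]
      exact lintegral_mono_set (Ioc_subset_Ioc_right (by linarith [hs.1])))
  have hslice : ∀ᵐ t ∂(volume.restrict (Ioc 0 T₀)),
      IntegrableOn (fun q : ℝ × ℝ => pbar q.2 (t - q.1) • G q.2 q.1) (Ioc 0 t ×ˢ Ioi (0:ℝ)) := by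
    filter_upwards [hint1.prod_right_ae, ae_restrict_mem measurableSet_Ioc] with t ht ht'
    exact integrableOn_of_integrable_potentialIntegrand_slice ht' ht
  have hu' : ∀ᵐ t ∂(volume.restrict (Ioc 0 T₀)),
      u t = ∫ q in Ioc 0 t ×ˢ Ioi (0:ℝ), pbar q.2 (t - q.1) • G q.2 q.1 := by
    filter_upwards [hslice, ae_restrict_mem measurableSet_Ioc] with t ht ht'
    refine (hu t).trans (Eq.trans ?_ (setIntegral_prod _ ht).symm)
    refine integral_congr_ae ?_
    filter_upwards [hff'T t ht'.2] with s hs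
    refine setIntegral_congr_fun measurableSet_Ioi fun r hr => ?_
    simp only [hGdef, max_eq_left (le_of_lt (mem_Ioi.1 hr)), hs]
  refine ⟨?_, ?_, fun T hT => ?_⟩
  · filter_upwards [hslice, ae_restrict_mem measurableSet_Ioc] with t ht ht'
    refine ht.congr_fun_ae ?_
    have h1 : (volume : Measure (ℝ × ℝ)).restrict (Ioc 0 t ×ˢ Ioi 0)
        = (volume.restrict (Ioc 0 t)).prod (volume.restrict (Ioi 0)) :=
      (Measure.prod_restrict _ _).symm
    filter_upwards [ae_restrict_mem (measurableSet_Ioc.prod measurableSet_Ioi),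
      h1 ▸ Measure.quasiMeasurePreserving_fst.ae (hff'T t ht'.2)] with q hq hq'
    simp only [hGdef, max_eq_left (le_of_lt (mem_Ioi.1 hq.2)), hq']
  · refine hint1.integral_prod_left.congr ?_
    filter_upwards [hu', ae_restrict_mem measurableSet_Ioc] with t ht ht'
    rw [integral_potentialIntegrand_slice ht', ht, one_smul]
  have hκm : Measurable fun t => w (T - t) := hwm.comp (by fun_prop)
  have hint := hΦint T hT.2 (fun t => w (T - t)) hκm (fun t => hw0 _) 1 ENNReal.one_ne_top
    (hwconv T)
  have hwu : ∀ᵐ t ∂(volume.restrict (Ioc 0 T)),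
      w (T - t) • u t = ∫ q, potentialIntegrand pbar (fun t => w (T - t)) G (t, q)
        ∂((volume.restrict (Ioc 0 T)).prod (volume.restrict (Ioi (0:ℝ)))) := by
    filter_upwards [ae_restrict_of_ae_restrict_of_subset (Ioc_subset_Ioc_right hT.2) hu',
      ae_restrict_mem measurableSet_Ioc] with t ht ht'
    rw [integral_potentialIntegrand_slice ht', ht]
  constructor
  · calc ∫⁻ t in Ioc (0:ℝ) T, ENNReal.ofReal (w (T - t) * ‖u t‖)
        ≤ ∫⁻ t in Ioc (0:ℝ) T, ∫⁻ q, ‖potentialIntegrand pbar (fun t => w (T - t)) G (t, q)‖ₑ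
          ∂((volume.restrict (Ioc 0 T)).prod (volume.restrict (Ioi (0:ℝ)))) := by
          refine lintegral_mono_ae ?_
          filter_upwards [hwu] with t ht
          rw [← Real.norm_of_nonneg (hw0 (T - t)), ← norm_smul, ofReal_norm, ht]
          exact enorm_integral_le_lintegral_enorm _
      _ = ∫⁻ z, ‖potentialIntegrand pbar (fun t => w (T - t)) G z‖ₑ
          ∂((volume.restrict (Ioc 0 T)).prod
            ((volume.restrict (Ioc 0 T)).prod (volume.restrict (Ioi (0:ℝ))))) :=
          (lintegral_prod _ hint.1.enorm).symm
      _ ≤ 1 * ∫⁻ s in Ioc 0 T, ENNReal.ofReal M * ‖f' s‖ₑ :=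
          lintegral_enorm_potentialIntegrand_le hpbar_meas hpbar_nn hκm (fun t => hw0 _) hGm hbm
            hGb (hwconv T)
      _ = ENNReal.ofReal (M * ∫ s in Ioc (0:ℝ) T, ‖f s‖) := by rw [one_mul, hfT T hT.2]
  · rw [integral_congr_ae hwu, integral_integral_swap (f := fun t q =>
      potentialIntegrand pbar (fun t => w (T - t)) G (t, q)) hint,
      integral_prod _ hint.integral_prod_right]
    refine integral_congr_ae ?_
    filter_upwards [hff'T T hT.2, ae_restrict_mem measurableSet_Ioc] with s hs hs'
    refine setIntegral_congr_fun measurableSet_Ioi fun r hr => ?_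
    simp only [integral_potentialIntegrand_time hs', hGdef,
      max_eq_left (le_of_lt (mem_Ioi.1 hr)), hs, sub_add_eq_sub_sub]
end

section
/- Let T₀ ∈ (0,∞) and let f : (0,T₀] → 𝔹 be strongly measurable with ‖f(s)‖ ≤ K < ∞ for a.e. s ∈ (0,T₀]. Then u(t) := ∫₀^t ∫₀^∞ P⁰_r f(s) p̄(r, t−s) dr ds is well defined as an element of 𝔹 for every t ∈ (0,T₀], sup_{t∈(0,T₀]} ‖u(t)‖ < ∞, the map t ↦ u(t) is continuous from (0,T₀] to 𝔹, and ‖u(t)‖ → 0 as t ↓ 0. -/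
open MeasureTheory Filter Set
open scoped ENNReal Topology

/-- The Laplace exponent of an infinite Lévy measure is positive. -/
lemma laplaceExponent_pos {ν : Measure ℝ}
    (hν_loc : ∫⁻ x in Ioi (0 : ℝ), ENNReal.ofReal (min 1 x) ∂ν ≠ ⊤)
    (hν_inf : ν (Ioi (0 : ℝ)) = ⊤) {l : ℝ} (hl : 0 < l) :
    0 < ∫ x in Ioi (0 : ℝ), (1 - Real.exp (-l * x)) ∂ν := by
  have hmin : IntegrableOn (fun x : ℝ => min 1 x) (Ioi 0) ν := by
    refine ⟨by fun_prop, ?_⟩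
    rw [hasFiniteIntegral_iff_ofReal]
    · exact hν_loc.lt_top
    · filter_upwards [ae_restrict_mem measurableSet_Ioi] with x hx
      exact le_min zero_le_one (le_of_lt hx)
  have hpos : ∀ x ∈ Ioi (0 : ℝ), 0 < 1 - Real.exp (-l * x) := fun x hx => by
    have : Real.exp (-l * x) < 1 := Real.exp_lt_one_iff.2 (by nlinarith [mem_Ioi.1 hx])
    linarith
  have hint : IntegrableOn (fun x : ℝ => 1 - Real.exp (-l * x)) (Ioi 0) ν := by
    refine (hmin.const_mul (max 1 l)).mono' (by fun_prop) ?_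
    filter_upwards [ae_restrict_mem measurableSet_Ioi] with x hx
    have hx0 : 0 < x := hx
    rw [Real.norm_of_nonneg (hpos x hx).le]
    rcases le_total x 1 with h | h
    · rw [min_eq_right h]
      nlinarith [Real.add_one_le_exp (-l * x), le_max_right 1 l]
    · rw [min_eq_left h]
      nlinarith [Real.exp_pos (-l * x), le_max_left 1 l]
  rw [setIntegral_pos_iff_support_of_nonneg_ae _ hint]
  · have hsub : Ioi 0 ⊆ Function.support fun x : ℝ => 1 - Real.exp (-l * x) :=
      fun x hx => (hpos x hx).ne'
    rw [inter_eq_right.2 hsub, hν_inf]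
    exact ENNReal.zero_lt_top
  · filter_upwards [ae_restrict_mem measurableSet_Ioi] with x hx
    exact (hpos x hx).le

/-- Chernoff bound for the lower tail of a measure in terms of its Laplace transform. -/
lemma measure_Icc_le_of_laplace {μ : Measure ℝ} [IsFiniteMeasure μ] {l a T : ℝ} (hl : 0 ≤ l)
    (h : ∫ s, Real.exp (-l * s) ∂μ = Real.exp a) :
    μ (Icc 0 T) ≤ ENNReal.ofReal (Real.exp (l * T) * Real.exp a) := by
  have hint : Integrable (fun s => Real.exp (-l * s)) μ := by
    by_contra hc
    rw [integral_undef hc] at h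
    exact (Real.exp_pos a).ne h
  have key := mul_meas_ge_le_integral_of_nonneg (μ := μ)
    (Eventually.of_forall fun s => (Real.exp_pos (-l * s)).le) hint (Real.exp (-(l * T)))
  rw [h] at key
  have hsub : Icc 0 T ⊆ {s | Real.exp (-(l * T)) ≤ Real.exp (-l * s)} := fun s hs => by
    simp only [mem_ofPred_eq, Real.exp_le_exp]
    nlinarith [hs.2]
  refine (measure_mono hsub).trans ?_
  rw [← ofReal_measureReal]
  refine ENNReal.ofReal_le_ofReal ?_
  calc _ = Real.exp (l * T) * (Real.exp (-(l * T)) * μ.real _) := by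
        rw [← mul_assoc, ← Real.exp_add, add_neg_cancel, Real.exp_zero, one_mul]
    _ ≤ _ := mul_le_mul_of_nonneg_left key (Real.exp_pos _).le

/-- A family of densities whose Laplace transforms decay exponentially in the index is
integrable over bounded times and all indices. -/
lemma integrable_indicator_density {μr : ℝ → Measure ℝ} {p : ℝ → ℝ → ℝ} {l a T : ℝ}
    (hprob : ∀ r : ℝ, 0 < r → IsProbabilityMeasure (μr r))
    (hl : 0 ≤ l) (ha : 0 < a)
    (hlap : ∀ r : ℝ, 0 < r → ∫ s, Real.exp (-l * s) ∂(μr r) = Real.exp (-r * a))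
    (hp_nn : ∀ r t : ℝ, 0 ≤ p r t) (hp_meas : Measurable (Function.uncurry p))
    (hdens : ∀ r : ℝ, 0 < r → ∀ A : Set ℝ, MeasurableSet A →
      μr r A = ∫⁻ t in A ∩ Ici 0, ENNReal.ofReal (p r t)) :
    Integrable ((Icc (0 : ℝ) T ×ˢ Ioi (0 : ℝ)).indicator fun z : ℝ × ℝ => p z.2 z.1) := by
  have hmeas : Measurable fun z : ℝ × ℝ => p z.2 z.1 := hp_meas.comp measurable_swap
  rw [integrable_indicator_iff (measurableSet_Icc.prod measurableSet_Ioi)]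
  refine ⟨hmeas.aestronglyMeasurable, ?_⟩
  rw [hasFiniteIntegral_iff_ofReal (Eventually.of_forall fun z => hp_nn _ _),
    Measure.volume_eq_prod, ← Measure.prod_restrict, lintegral_prod_symm' _ hmeas.ennreal_ofReal]
  have hexp : IntegrableOn (fun r : ℝ => Real.exp (l * T) * Real.exp (-r * a)) (Ioi 0) := by
    simp_rw [neg_mul, mul_comm _ a, ← neg_mul]
    exact (exp_neg_integrableOn_Ioi 0 ha).const_mul _
  refine lt_of_le_of_lt (lintegral_mono_ae ?_) hexp.lintegral_lt_top
  filter_upwards [ae_restrict_mem measurableSet_Ioi] with r hr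
  have := hprob r hr
  have hIcc := hdens r hr (Icc 0 T) measurableSet_Icc
  rw [inter_eq_left.2 Icc_subset_Ici_self] at hIcc
  rw [← hIcc]
  exact measure_Icc_le_of_laplace hl (hlap r hr)

/-- Integrating an `L¹` function against an essentially bounded function is Lipschitz. -/
lemma lipschitzWith_integral_smul {α E : Type*} [MeasurableSpace α] {μ : Measure α}
    [NormedAddCommGroup E] [NormedSpace ℝ E] {G : α → E} (hG : AEStronglyMeasurable G μ)
    {C : NNReal} (hGC : ∀ᵐ z ∂μ, ‖G z‖ ≤ C) :
    LipschitzWith C fun h : Lp ℝ 1 μ => ∫ z, h z • G z ∂μ := by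
  refine LipschitzWith.of_dist_le_mul fun h h' => ?_
  have hi : ∀ h : Lp ℝ 1 μ, Integrable (fun z => h z • G z) μ := fun h =>
    (L1.integrable_coeFn h).smul_bdd C hG hGC
  rw [dist_eq_norm, dist_eq_norm, ← integral_sub (hi h) (hi h'), L1.norm_eq_integral_norm,
    ← integral_const_mul]
  refine norm_integral_le_of_norm_le ((L1.integrable_coeFn (h - h')).norm.const_mul _) ?_
  filter_upwards [hGC, Lp.coeFn_sub h h'] with z hz hs
  rw [← sub_smul, hs, Pi.sub_apply, norm_smul, mul_comm]
  gcongr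

lemma measurePreserving_reflect_prodMk (t : ℝ) :
    MeasurePreserving (fun z : ℝ × ℝ => (t - z.1, z.2)) :=
  (volume.measurePreserving_sub_left t).prod (MeasurePreserving.id volume)

/-- Convolution in the first variable of an integrable kernel with an essentially bounded function
is continuous. -/
lemma continuous_integral_reflect_smul {E : Type*} [NormedAddCommGroup E] [NormedSpace ℝ E]
    {q : ℝ × ℝ → ℝ} (hq : Integrable q) {G : ℝ × ℝ → E} (hG : AEStronglyMeasurable G)
    {C : NNReal} (hGC : ∀ᵐ z, ‖G z‖ ≤ C) :
    Continuous fun t : ℝ => ∫ z : ℝ × ℝ, q (t - z.1, z.2) • G z := by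
  let τ : C(ℝ, C(ℝ × ℝ, ℝ × ℝ)) :=
    ContinuousMap.curry ⟨fun x : ℝ × ℝ × ℝ => (x.1 - x.2.1, x.2.2), by fun_prop⟩
  have hQ : Continuous fun t : ℝ =>
      Lp.compMeasurePreserving (τ t) (measurePreserving_reflect_prodMk t) hq.toL1 :=
    Continuous.compMeasurePreservingLp continuous_const τ.continuous
      measurePreserving_reflect_prodMk ENNReal.one_ne_top
  refine ((lipschitzWith_integral_smul hG hGC).continuous.comp hQ).congr fun t => ?_
  refine integral_congr_ae ?_
  filter_upwards [Lp.coeFn_compMeasurePreserving hq.toL1 (measurePreserving_reflect_prodMk t),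
    (measurePreserving_reflect_prodMk t).quasiMeasurePreserving.ae hq.coeFn_toL1] with z hz hz'
  exact congrArg (· • G z) (hz.trans hz')

/-- A bounded strongly continuous family of operators on `[0, ∞)` is jointly continuous. -/
lemma continuous_uncurry_of_strongly_continuous {E : Type*} [NormedAddCommGroup E]
    [NormedSpace ℝ E] {P : ℝ → E →L[ℝ] E} {M : ℝ} (hM : ∀ t : ℝ, 0 ≤ t → ‖P t‖ ≤ M)
    (hP : ∀ g : E, ContinuousOn (fun t => P t g) (Ici (0 : ℝ))) :
    Continuous fun x : E × ℝ => P (max x.2 0) x.1 := by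
  refine continuous_prod_of_continuous_lipschitzWith _ M.toNNReal (fun g => ?_) fun r => ?_
  · exact (hP g).comp_continuous (by fun_prop) fun r => le_max_right r 0
  · refine (P (max r 0)).lipschitz.weaken ?_
    exact NNReal.le_toNNReal_of_coe_le (hM _ (le_max_right r 0))

/-- Proposition 2.3(ii).  If `‖f(s)‖ ≤ K` for a.e. `s ∈ (0,T₀]`, then
`u(t) = ∫₀^t ∫₀^∞ P⁰_r f(s) p̄(r,t−s) dr ds` is well defined in `𝔹` for every `t ∈ (0,T₀]`,
`sup_{t∈(0,T₀]} ‖u(t)‖ < ∞`, `t ↦ u(t)` is continuous on `(0,T₀]`, and `u(t) → 0` as `t ↓ 0`. -/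
theorem time_frac_stmt2
    {𝔹 : Type*} [NormedAddCommGroup 𝔹] [NormedSpace ℝ 𝔹] [CompleteSpace 𝔹]
    (ν : Measure ℝ)
    (hν_loc : ∫⁻ x in Set.Ioi (0:ℝ), ENNReal.ofReal (min 1 x) ∂ν ≠ ⊤)
    (hν_inf : ν (Set.Ioi (0:ℝ)) = ⊤)
    (φ : ℝ → ℝ)
    (hφ : ∀ l : ℝ, 0 < l → φ l = ∫ x in Set.Ioi (0:ℝ), (1 - Real.exp (-l * x)) ∂ν)
    (w : ℝ → ℝ)
    (hw : ∀ x : ℝ, w x = (ν (Set.Ioi x)).toReal)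
    (μr : ℝ → Measure ℝ)
    (hprob : ∀ r : ℝ, 0 < r → IsProbabilityMeasure (μr r))
    (hlap : ∀ r : ℝ, 0 < r → ∀ l : ℝ, 0 < l →
      ∫ s, Real.exp (-l * s) ∂(μr r) = Real.exp (-r * φ l))
    (pbar : ℝ → ℝ → ℝ)
    (hpbar_nn : ∀ r t : ℝ, 0 ≤ pbar r t)
    (hpbar_meas : Measurable (Function.uncurry pbar))
    (hpbar_bdd : ∀ r : ℝ, 0 < r → ∃ C : ℝ, ∀ t : ℝ, pbar r t ≤ C)
    (hdens : ∀ r : ℝ, 0 < r → ∀ A : Set ℝ, MeasurableSet A →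
      μr r A = ∫⁻ t in A ∩ Set.Ici 0, ENNReal.ofReal (pbar r t))
    -- uniformly bounded strongly continuous semigroup on 𝔹
    (P : ℝ → 𝔹 →L[ℝ] 𝔹)
    (hP0 : P 0 = ContinuousLinearMap.id ℝ 𝔹)
    (hPsemi : ∀ s t : ℝ, 0 ≤ s → 0 ≤ t → P (s + t) = (P s).comp (P t))
    (M : ℝ) (hM : ∀ t : ℝ, 0 ≤ t → ‖P t‖ ≤ M)
    (hPcont : ∀ g : 𝔹, ContinuousOn (fun t => P t g) (Set.Ici (0:ℝ)))
    -- the data f, essentially bounded by K, and the candidate solution u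
    (T₀ : ℝ) (hT₀ : 0 < T₀)
    (f : ℝ → 𝔹)
    (hf_meas : AEStronglyMeasurable f (volume.restrict (Set.Ioc (0:ℝ) T₀)))
    (K : ℝ)
    (hfK : ∀ᵐ s ∂(volume.restrict (Set.Ioc (0:ℝ) T₀)), ‖f s‖ ≤ K)
    (u : ℝ → 𝔹)
    (hu : ∀ t : ℝ, u t =
      ∫ s in Set.Ioc (0:ℝ) t, ∫ r in Set.Ioi (0:ℝ), pbar r (t - s) • P r (f s)) :
    (∀ t ∈ Set.Ioc (0:ℝ) T₀,
      IntegrableOn (fun p : ℝ × ℝ => pbar p.2 (t - p.1) • P p.2 (f p.1))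
        ((Set.Ioc (0:ℝ) t) ×ˢ (Set.Ioi (0:ℝ)))) ∧
    (∃ C : ℝ, ∀ t ∈ Set.Ioc (0:ℝ) T₀, ‖u t‖ ≤ C) ∧
    ContinuousOn u (Set.Ioc (0:ℝ) T₀) ∧
    Tendsto u (nhdsWithin 0 (Set.Ioi (0:ℝ))) (nhds 0) := by
  have ha : 0 < φ (1 / T₀) := by
    rw [hφ _ (one_div_pos.2 hT₀)]
    exact laplaceExponent_pos hν_loc hν_inf (one_div_pos.2 hT₀)
  let q : ℝ × ℝ → ℝ :=
    (Icc (0 : ℝ) T₀ ×ˢ Ioi (0 : ℝ)).indicator fun z => pbar z.2 z.1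
  have hq : Integrable q := integrable_indicator_density hprob (one_div_pos.2 hT₀).le ha
    (fun r hr => hlap r hr _ (one_div_pos.2 hT₀)) hpbar_nn hpbar_meas hdens
  let f' : ℝ → 𝔹 := (Ioc (0 : ℝ) T₀).indicator (hf_meas.mk f)
  have hf' : StronglyMeasurable f' := hf_meas.stronglyMeasurable_mk.indicator measurableSet_Ioc
  have hff' : ∀ᵐ s, s ∈ Ioc (0 : ℝ) T₀ → f s = f' s := by
    rw [← ae_restrict_iff' measurableSet_Ioc]
    filter_upwards [hf_meas.ae_eq_mk, ae_restrict_mem measurableSet_Ioc] with s hs hmem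
    rw [hs]
    exact (indicator_of_mem hmem _).symm
  have hf'K : ∀ᵐ s, ‖f' s‖ ≤ |K| := by
    filter_upwards [hff', (ae_restrict_iff' measurableSet_Ioc).1 hfK] with s hs hK
    by_cases hmem : s ∈ Ioc (0 : ℝ) T₀
    · rw [← hs hmem]
      exact (hK hmem).trans (le_abs_self K)
    · simp only [f', indicator_of_notMem hmem, norm_zero, abs_nonneg]
  have hM0 : 0 ≤ M := (norm_nonneg _).trans (hM 0 le_rfl)
  let G : ℝ × ℝ → 𝔹 := fun z => P (max z.2 0) (f' z.1)
  have hG : AEStronglyMeasurable G :=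
    ((continuous_uncurry_of_strongly_continuous hM hPcont).comp_stronglyMeasurable
      ((hf'.comp_measurable measurable_fst).prodMk
        measurable_snd.stronglyMeasurable)).aestronglyMeasurable
  have hfst : Measure.QuasiMeasurePreserving (Prod.fst : ℝ × ℝ → ℝ) :=
    Measure.quasiMeasurePreserving_fst
  have hGC : ∀ᵐ z, ‖G z‖ ≤ (⟨M * |K|, by positivity⟩ : NNReal) := by
    filter_upwards [hfst.ae hf'K] with z hz
    exact (P (max z.2 0)).le_of_opNorm_le_of_le (hM _ (le_max_right _ _)) hz
  let v : ℝ → 𝔹 := fun t => ∫ z : ℝ × ℝ, q (t - z.1, z.2) • G z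
  have hv : Continuous v := continuous_integral_reflect_smul hq hG hGC
  have hH : ∀ t, Integrable fun z : ℝ × ℝ => q (t - z.1, z.2) • G z := fun t =>
    ((measurePreserving_reflect_prodMk t).integrable_comp_of_integrable hq).smul_bdd _ hG hGC
  have hH0 : ∀ t, ∀ z ∉ Ioc (0 : ℝ) t ×ˢ Ioi (0 : ℝ), q (t - z.1, z.2) • G z = 0 := by
    intro t z hz
    by_cases hs : 0 < z.1
    · have hmem : (t - z.1, z.2) ∉ Icc (0 : ℝ) T₀ ×ˢ Ioi (0 : ℝ) := fun h =>
        hz ⟨⟨hs, sub_nonneg.1 h.1.1⟩, h.2⟩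
      simp only [q, indicator_of_notMem hmem, zero_smul]
    · have hmem : z.1 ∉ Ioc (0 : ℝ) T₀ := fun h => hs h.1
      simp only [G, f', indicator_of_notMem hmem, map_zero, smul_zero]
  have hFH : ∀ t ∈ Ioc (0 : ℝ) T₀,
      (fun p : ℝ × ℝ => pbar p.2 (t - p.1) • P p.2 (f p.1))
        =ᵐ[volume.restrict (Ioc (0 : ℝ) t ×ˢ Ioi (0 : ℝ))]
      fun z => q (t - z.1, z.2) • G z := by
    intro t ht
    filter_upwards [ae_restrict_of_ae (hfst.ae hff'),
      ae_restrict_mem (measurableSet_Ioc.prod measurableSet_Ioi)] with z hz hmem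
    obtain ⟨⟨h1, h2⟩, h3⟩ := hmem
    have hmem : (t - z.1, z.2) ∈ Icc (0 : ℝ) T₀ ×ˢ Ioi (0 : ℝ) :=
      ⟨⟨sub_nonneg.2 h2, by linarith [ht.2]⟩, h3⟩
    simp only [q, G, indicator_of_mem hmem, hz ⟨h1, h2.trans ht.2⟩, max_eq_left (mem_Ioi.1 h3).le]
  have hF : ∀ t ∈ Ioc (0 : ℝ) T₀,
      IntegrableOn (fun p : ℝ × ℝ => pbar p.2 (t - p.1) • P p.2 (f p.1))
        (Ioc (0 : ℝ) t ×ˢ Ioi (0 : ℝ)) := fun t ht =>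
    (hH t).integrableOn.congr (hFH t ht).symm
  have huv : EqOn u v (Ioc 0 T₀) := fun t ht => by
    have hprod := setIntegral_prod _ (hF t ht)
    rw [hu, ← hprod, ← Measure.volume_eq_prod, integral_congr_ae (hFH t ht)]
    exact setIntegral_eq_integral_of_forall_compl_eq_zero (hH0 t)
  have hv0 : v 0 = 0 := by
    refine integral_eq_zero_of_ae (Eventually.of_forall fun z => hH0 0 z ?_)
    simp
  refine ⟨hF, ?_, hv.continuousOn.congr huv, ?_⟩
  · obtain ⟨C, hC⟩ := (isCompact_Icc (a := 0) (b := T₀)).exists_bound_of_continuousOn hv.continuousOn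
    exact ⟨C, fun t ht => huv ht ▸ hC t (Ioc_subset_Icc_self ht)⟩
  · have hlim : Tendsto v (𝓝[>] 0) (𝓝 0) := hv0 ▸ hv.continuousAt.mono_left nhdsWithin_le_nhds
    refine hlim.congr' ?_
    filter_upwards [Ioc_mem_nhdsGT hT₀] with t ht
    exact (huv ht).symm
end

section
/- Uniqueness of strong solutions: Let T₀ ∈ (0,∞), g ∈ 𝔹, and let f : (0,T₀] → 𝔹 be Bochner integrable. Call u : [0,T₀] → 𝔹 a strong solution of ∂ᵗ_w u = 𝓛u + f with u(0) = g if: (i) t ↦ u(t) is continuous on [0,T₀], u(0) = g, and sup_{t∈[0,T₀]} ‖u(t)‖ < ∞; (ii) u(t) ∈ 𝒟(𝓛) for a.e. t ∈ (0,T₀] and ∫₀^{T₀} ‖𝓛u(t)‖ dt < ∞; (iii) for every T ∈ (0,T₀], ∫₀^T w(T−t) ‖u(t)−g‖ dt < ∞ and ∫₀^T w(T−t)(u(t)−g) dt = ∫₀^T (f(t) + 𝓛u(t)) dt in 𝔹. Then any two strong solutions coincide on [0,T₀]. -/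
open MeasureTheory Filter Set
open scoped ENNReal Topology

section Semigroup

variable {E : Type*} [NormedAddCommGroup E] [NormedSpace ℝ E]

/-- The orbit of a vector in the domain of the generator is right differentiable. -/
theorem semigroup_hasDerivWithinAt {P : ℝ → E →L[ℝ] E}
    (hP : ∀ s t : ℝ, 0 ≤ s → 0 ≤ t → P (s + t) = (P s).comp (P t)) {x y : E}
    (hxy : Tendsto (fun h : ℝ => h⁻¹ • (P h x - x)) (𝓝[>] 0) (𝓝 y)) {t : ℝ} (ht : 0 ≤ t) :
    HasDerivWithinAt (fun s => P s x) (P t y) (Ici t) t := by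
  rw [← hasDerivWithinAt_Ioi_iff_Ici, hasDerivWithinAt_iff_tendsto_slope' (by simp)]
  have h1 : Tendsto (fun s : ℝ => s - t) (𝓝[>] t) (𝓝[>] 0) := by
    refine tendsto_nhdsWithin_iff.2 ⟨?_, ?_⟩
    · have : Tendsto (fun s : ℝ => s - t) (𝓝 t) (𝓝 (t - t)) :=
        (continuous_id.sub continuous_const).tendsto t
      rw [sub_self] at this
      exact this.mono_left nhdsWithin_le_nhds
    · filter_upwards [self_mem_nhdsWithin] with s hs
      exact sub_pos.2 (mem_Ioi.1 hs)
  refine (((P t).continuous.tendsto y).comp (hxy.comp h1)).congr' ?_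
  filter_upwards [self_mem_nhdsWithin] with s hs
  have h2 := congrArg (fun A => A x) (hP t (s - t) ht (sub_pos.2 (mem_Ioi.1 hs)).le)
  simp only [add_sub_cancel, ContinuousLinearMap.comp_apply] at h2
  simp [slope_def_module, h2]

theorem semigroup_norm_sub_le {P : ℝ → E →L[ℝ] E} (hP0 : P 0 = ContinuousLinearMap.id ℝ E)
    (hP : ∀ s t : ℝ, 0 ≤ s → 0 ≤ t → P (s + t) = (P s).comp (P t))
    {M : ℝ} (hM : ∀ t : ℝ, 0 ≤ t → ‖P t‖ ≤ M)
    (hPcont : ∀ g : E, ContinuousOn (fun t => P t g) (Ici (0:ℝ))) {x y : E}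
    (hxy : Tendsto (fun h : ℝ => h⁻¹ • (P h x - x)) (𝓝[>] 0) (𝓝 y)) {t : ℝ} (ht : 0 ≤ t) :
    ‖P t x - x‖ ≤ M * ‖y‖ * t := by
  refine image_norm_le_of_norm_deriv_right_le_deriv_boundary (a := 0) (b := t)
    (f := fun s => P s x - x) (f' := fun s => P s y)
    (B := fun s => M * ‖y‖ * s) (B' := fun _ => M * ‖y‖)
    (((hPcont x).mono Icc_subset_Ici_self).sub continuousOn_const)
    (fun s hs => (semigroup_hasDerivWithinAt hP hxy hs.1).sub_const x) (by simp [hP0])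
    (fun s => by simpa using (hasDerivAt_id s).const_mul (M * ‖y‖))
    (fun s hs => (P s).le_of_opNorm_le (hM s hs.1) y) ⟨ht, le_rfl⟩

/-- Hille–Yosida estimate for the resolvent of a bounded semigroup. -/
theorem semigroup_resolvent_norm_le {P : ℝ → E →L[ℝ] E}
    (hP0 : P 0 = ContinuousLinearMap.id ℝ E)
    (hP : ∀ s t : ℝ, 0 ≤ s → 0 ≤ t → P (s + t) = (P s).comp (P t))
    {M : ℝ} (hM : ∀ t : ℝ, 0 ≤ t → ‖P t‖ ≤ M)
    (hPcont : ∀ g : E, ContinuousOn (fun t => P t g) (Ici (0:ℝ))) {x y : E}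
    (hxy : Tendsto (fun h : ℝ => h⁻¹ • (P h x - x)) (𝓝[>] 0) (𝓝 y)) {c : ℝ} (hc : 0 < c) :
    ‖x‖ ≤ M / c * ‖c • x - y‖ := by
  have hM0 : 0 ≤ M := (norm_nonneg _).trans (hM 0 le_rfl)
  have hexp : ∀ s : ℝ, HasDerivAt (fun s : ℝ => Real.exp (-c * s)) (-c * Real.exp (-c * s)) s := by
    intro s
    have := ((hasDerivAt_id s).const_mul (-c)).exp
    simpa [mul_comm] using this
  have key : ∀ t : ℝ, 0 ≤ t →
      ‖x‖ ≤ Real.exp (-c * t) * (M * ‖x‖) + M / c * ‖c • x - y‖ := by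
    intro t ht
    have h1 : ‖Real.exp (-c * t) • P t x - x‖ ≤
        M / c * ‖c • x - y‖ * (1 - Real.exp (-c * t)) := by
      refine image_norm_le_of_norm_deriv_right_le_deriv_boundary (a := 0) (b := t)
        (f := fun s => Real.exp (-c * s) • P s x - x)
        (f' := fun s => Real.exp (-c * s) • P s y + (-c * Real.exp (-c * s)) • P s x)
        (B := fun s => M / c * ‖c • x - y‖ * (1 - Real.exp (-c * s)))
        (B' := fun s => M / c * ‖c • x - y‖ * -(-c * Real.exp (-c * s)))
        ((ContinuousOn.smul (by fun_prop) ((hPcont x).mono Icc_subset_Ici_self)).sub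
          continuousOn_const)
        (fun s hs => ((hexp s).hasDerivWithinAt.smul
          (semigroup_hasDerivWithinAt hP hxy hs.1)).sub_const x) (by simp [hP0])
        (fun s => ((hexp s).const_sub 1).const_mul _) (fun s hs => ?_) ⟨ht, le_rfl⟩
      have h2 : Real.exp (-c * s) • P s y + (-c * Real.exp (-c * s)) • P s x
          = -(Real.exp (-c * s) • P s (c • x - y)) := by
        simp only [map_sub, map_smul, smul_sub, smul_smul]
        module
      rw [h2, norm_neg, norm_smul, Real.norm_of_nonneg (Real.exp_nonneg _)]
      have h3 := (P s).le_of_opNorm_le (hM s hs.1) (c • x - y)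
      calc _ ≤ Real.exp (-c * s) * (M * ‖c • x - y‖) := by gcongr
        _ = _ := by field_simp
    have h4 : ‖Real.exp (-c * t) • P t x‖ ≤ Real.exp (-c * t) * (M * ‖x‖) := by
      rw [norm_smul, Real.norm_of_nonneg (Real.exp_nonneg _)]
      gcongr
      exact (P t).le_of_opNorm_le (hM t ht) x
    have h5 : M / c * ‖c • x - y‖ * (1 - Real.exp (-c * t)) ≤ M / c * ‖c • x - y‖ := by
      refine mul_le_of_le_one_right (by positivity) ?_
      linarith [Real.exp_nonneg (-c * t)]
    have h6 := norm_sub_norm_le x (Real.exp (-c * t) • P t x)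
    rw [norm_sub_rev] at h6
    linarith
  have hlim : Tendsto (fun t : ℝ => Real.exp (-c * t) * (M * ‖x‖) + M / c * ‖c • x - y‖) atTop
      (𝓝 (0 * (M * ‖x‖) + M / c * ‖c • x - y‖)) := by
    refine Tendsto.add_const _ (Tendsto.mul_const _ (Real.tendsto_exp_atBot.comp ?_))
    exact tendsto_id.const_mul_atTop_of_neg (neg_lt_zero.2 hc)
  rw [zero_mul, zero_add] at hlim
  exact ge_of_tendsto hlim ((eventually_ge_atTop 0).mono key)

/-- The generator of a bounded semigroup commutes with Bochner integrals. -/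
theorem semigroup_generator_integral [CompleteSpace E] {P : ℝ → E →L[ℝ] E}
    (hP0 : P 0 = ContinuousLinearMap.id ℝ E)
    (hP : ∀ s t : ℝ, 0 ≤ s → 0 ≤ t → P (s + t) = (P s).comp (P t))
    {M : ℝ} (hM : ∀ t : ℝ, 0 ≤ t → ‖P t‖ ≤ M)
    (hPcont : ∀ g : E, ContinuousOn (fun t => P t g) (Ici (0:ℝ)))
    {α : Type*} [MeasurableSpace α] {μ : Measure α} {z Lz : α → E}
    (hz : Integrable z μ) (hLz : Integrable Lz μ)
    (hdom : ∀ᵐ a ∂μ, Tendsto (fun h : ℝ => h⁻¹ • (P h (z a) - z a)) (𝓝[>] 0) (𝓝 (Lz a))) :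
    Tendsto (fun h : ℝ => h⁻¹ • (P h (∫ a, z a ∂μ) - ∫ a, z a ∂μ)) (𝓝[>] 0)
      (𝓝 (∫ a, Lz a ∂μ)) := by
  have h1 : ∀ h : ℝ, h⁻¹ • (P h (∫ a, z a ∂μ) - ∫ a, z a ∂μ)
      = ∫ a, h⁻¹ • (P h (z a) - z a) ∂μ := by
    intro h
    rw [integral_smul, integral_sub ((P h).integrable_comp hz) hz,
      (P h).integral_comp_comm hz]
  simp_rw [h1]
  refine tendsto_integral_filter_of_dominated_convergence (fun a => M * ‖Lz a‖) ?_ ?_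
    (hLz.norm.const_mul M) hdom
  · exact Eventually.of_forall fun h =>
      ((((P h).integrable_comp hz).sub hz).smul h⁻¹).aestronglyMeasurable
  · filter_upwards [self_mem_nhdsWithin] with h hh
    filter_upwards [hdom] with a ha
    have hh' : 0 < h := hh
    have := semigroup_norm_sub_le hP0 hP hM hPcont ha hh'.le
    rw [norm_smul, norm_inv, Real.norm_of_nonneg hh'.le, inv_mul_le_iff₀ hh']
    linarith

end Semigroup

/-- Truncating the Laplace transform of a convolution at `T` costs only `O(exp (-l * T))`. -/
theorem norm_laplace_convolution_sub_truncation_le {E : Type*} [NormedAddCommGroup E]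
    [NormedSpace ℝ E] [CompleteSpace E] {w : ℝ → ℝ} {e : ℝ → E} {l T : ℝ} (hl : 0 < l)
    (hT : 0 < T) (hw : ∀ x, 0 < x → 0 ≤ w x) (hanti : AntitoneOn w (Ioi 0))
    (ha : IntegrableOn (fun s => l * Real.exp (-l * s) * w s) (Ioi 0))
    (he : IntegrableOn e (Ioc 0 T)) (hwe : IntegrableOn (fun t => w (T - t) • e t) (Ioc 0 T)) :
    ‖(∫ s in Ioi 0, l * Real.exp (-l * s) * w s) • (∫ t in Ioc 0 T, Real.exp (-l * t) • e t)
      - ∫ x in Ioc 0 T, (l * Real.exp (-l * x)) • ∫ t in Ioc 0 x, w (x - t) • e t‖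
      ≤ Real.exp (-l * T) * ∫ t in Ioc 0 T, ‖w (T - t) • e t‖ := by
  set a : ℝ → ℝ := fun s => l * Real.exp (-l * s) * w s with ha_def
  set b : ℝ → E := (Ioc 0 T).indicator (fun t => Real.exp (-l * t) • e t) with hb_def
  let L : E →L[ℝ] ℝ →L[ℝ] E := (ContinuousLinearMap.lsmul ℝ ℝ).flip
  have hb0 : IntegrableOn (fun t => Real.exp (-l * t) • e t) (Ioc 0 T) := by
    refine he.bdd_smul (C := 1) (by fun_prop) ?_
    filter_upwards [ae_restrict_mem measurableSet_Ioc] with t ht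
    rw [Real.norm_of_nonneg (Real.exp_nonneg _), Real.exp_le_one_iff]
    nlinarith [ht.1]
  have hb : Integrable b := (integrable_indicator_iff measurableSet_Ioc).2 hb0
  have hconv := integral_posConvolution (μ := volume) (ν := volume) hb.integrableOn ha L
  have hint := (integrable_posConvolution (μ := volume) (ν := volume) hb.integrableOn ha L)
  rw [posConvolution, integrable_indicator_iff measurableSet_Ioi] at hint
  have hbi : ∫ x in Ioi 0, b x = ∫ t in Ioc 0 T, Real.exp (-l * t) • e t := by
    rw [hb_def, setIntegral_indicator measurableSet_Ioc, inter_eq_self_of_subset_right]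
    exact Ioc_subset_Ioi_self
  have hpt : ∀ x t, L ((Real.exp (-l * t)) • e t) (a (x - t))
      = (l * Real.exp (-l * x)) • w (x - t) • e t := by
    intro x t
    have : Real.exp (-l * x) = Real.exp (-l * (x - t)) * Real.exp (-l * t) := by
      rw [← Real.exp_add]; ring_nf
    simp only [L, ContinuousLinearMap.flip_apply, ContinuousLinearMap.lsmul_apply, smul_smul,
      ha_def, this]
    congr 1
    ring
  have hval : ∀ x ∈ Ioc 0 T, ∫ t in (0:ℝ)..x, L (b t) (a (x - t))
      = (l * Real.exp (-l * x)) • ∫ t in Ioc 0 x, w (x - t) • e t := by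
    intro x hx
    rw [intervalIntegral.integral_of_le hx.1.le, ← integral_smul]
    refine setIntegral_congr_fun measurableSet_Ioc fun t ht => ?_
    have htT : t ∈ Ioc 0 T := ⟨ht.1, ht.2.trans hx.2⟩
    simp only [hb_def, indicator_of_mem htT, hpt]
  have htail : ∀ x ∈ Ioi T, ‖∫ t in (0:ℝ)..x, L (b t) (a (x - t))‖
      ≤ (l * Real.exp (-l * x)) * ∫ t in Ioc 0 T, ‖w (T - t) • e t‖ := by
    intro x hx
    have hx : T < x := hx
    have h1 : ∫ t in (0:ℝ)..x, L (b t) (a (x - t))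
        = ∫ t in Ioc 0 T, (l * Real.exp (-l * x)) • w (x - t) • e t := by
      rw [intervalIntegral.integral_of_le (hT.trans hx).le]
      have h2 : ∀ t, L (b t) (a (x - t))
          = (Ioc 0 T).indicator (fun t => (l * Real.exp (-l * x)) • w (x - t) • e t) t := by
        intro t
        by_cases ht : t ∈ Ioc 0 T
        · simp only [hb_def, indicator_of_mem ht, hpt]
        · simp [hb_def, indicator_of_notMem ht]
      simp_rw [h2]
      rw [setIntegral_indicator measurableSet_Ioc, inter_eq_self_of_subset_right]
      exact Ioc_subset_Ioc_right hx.le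
    rw [h1, integral_smul, norm_smul, Real.norm_of_nonneg (by positivity)]
    gcongr
    rw [integral_Ioc_eq_integral_Ioo, integral_Ioc_eq_integral_Ioo]
    refine norm_integral_le_of_norm_le (IntegrableOn.mono_set hwe.norm Ioo_subset_Ioc_self) ?_
    filter_upwards [ae_restrict_mem measurableSet_Ioo] with t ht
    have h3 : 0 < T - t := sub_pos.2 ht.2
    have h4 : T - t ≤ x - t := by linarith
    rw [norm_smul, norm_smul, Real.norm_of_nonneg (hw _ h3),
      Real.norm_of_nonneg (hw _ (h3.trans_le h4))]
    gcongr
    exact hanti h3 (h3.trans_le h4) h4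
  have hsplit : ∫ x in Ioi 0, (∫ t in (0:ℝ)..x, L (b t) (a (x - t)))
      = (∫ x in Ioc 0 T, ∫ t in (0:ℝ)..x, L (b t) (a (x - t)))
        + ∫ x in Ioi T, ∫ t in (0:ℝ)..x, L (b t) (a (x - t)) := by
    rw [← Ioc_union_Ioi_eq_Ioi hT.le]
    exact setIntegral_union (Ioc_disjoint_Ioi le_rfl) measurableSet_Ioi
      (hint.mono_set Ioc_subset_Ioi_self) (hint.mono_set (Ioi_subset_Ioi hT.le))
  have hL : L (∫ x in Ioi 0, b x) (∫ x in Ioi 0, a x)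
      = (∫ s in Ioi 0, a s) • ∫ t in Ioc 0 T, Real.exp (-l * t) • e t := by
    rw [hbi]; rfl
  rw [← hL, ← hconv, hsplit, setIntegral_congr_fun measurableSet_Ioc hval, add_sub_cancel_left]
  have hl' : -l < 0 := neg_lt_zero.2 hl
  calc _ ≤ ∫ x in Ioi T, (l * Real.exp (-l * x)) * ∫ t in Ioc 0 T, ‖w (T - t) • e t‖ := by
        refine norm_integral_le_of_norm_le
          (((integrableOn_exp_mul_Ioi hl' T).const_mul l).mul_const _) ?_
        filter_upwards [ae_restrict_mem measurableSet_Ioi] with x hx using htail x hx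
    _ = _ := by
        rw [integral_mul_const, integral_const_mul, integral_exp_mul_Ioi hl']
        field_simp

/-- A finite Laplace transform over `(0, T]` decaying like `exp (-n * T)` comes from a function
with vanishing primitive. -/
theorem setIntegral_eq_zero_of_norm_laplace_le {E : Type*} [NormedAddCommGroup E]
    [NormedSpace ℝ E] [CompleteSpace E] {h : ℝ → E} {T C : ℝ} (hh : IntegrableOn h (Ioc 0 T))
    (hC : ∀ n : ℕ, 1 ≤ n →
      ‖∫ t in Ioc 0 T, Real.exp (-(n : ℝ) * t) • h t‖ ≤ C * Real.exp (-(n : ℝ) * T))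
    {τ : ℝ} (hτ : τ ∈ Ioo 0 T) : ∫ t in Ioc 0 τ, h t = 0 := by
  have hC0 : 0 ≤ C := by
    have := (norm_nonneg _).trans (hC 1 le_rfl)
    exact nonneg_of_mul_nonneg_left this (Real.exp_pos _)
  have key : ∀ n : ℕ, 1 ≤ n →
      ‖(∫ t in Ioc 0 T, Real.exp (-Real.exp (n * (τ - t))) • h t) - ∫ t in Ioc 0 T, h t‖
        ≤ C * Real.exp (-(n * (T - τ))) * Real.exp 1 := by
    intro n hn
    let F : ℕ → ℝ → E := fun k t =>
      ((-Real.exp (n * (τ - t))) ^ k / (k.factorial : ℝ)) • h t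
    have hFb : ∀ k, ∀ t ∈ Ioc 0 T,
        ‖(-Real.exp (n * (τ - t))) ^ k / (k.factorial : ℝ)‖
          ≤ Real.exp (n * τ) ^ k / (k.factorial : ℝ) := by
      intro k t ht
      rw [norm_div, norm_pow, norm_neg, Real.norm_of_nonneg (Real.exp_nonneg _),
        Real.norm_of_nonneg (Nat.cast_nonneg _)]
      gcongr
      linarith [ht.1]
    have hFi : ∀ k, Integrable (F k) (volume.restrict (Ioc 0 T)) := by
      intro k
      refine hh.bdd_smul (C := Real.exp (n * τ) ^ k / (k.factorial : ℝ)) (by fun_prop) ?_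
      filter_upwards [ae_restrict_mem measurableSet_Ioc] with t ht using hFb k t ht
    have hFs : Summable fun k => ∫ t in Ioc 0 T, ‖F k t‖ := by
      refine Summable.of_nonneg_of_le (fun k => by positivity) (fun k => ?_)
        ((Real.summable_pow_div_factorial (Real.exp (n * τ))).mul_right
          (∫ t in Ioc 0 T, ‖h t‖))
      rw [← integral_const_mul]
      refine integral_mono_ae (hFi k).norm (hh.norm.const_mul _) ?_
      filter_upwards [ae_restrict_mem measurableSet_Ioc] with t ht
      rw [norm_smul]
      gcongr
      exact hFb k t ht
    have hsum := hasSum_integral_of_summable_integral_norm hFi hFs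
    have htsum : ∀ t, ∑' k, F k t = Real.exp (-Real.exp (n * (τ - t))) • h t := by
      intro t
      have := NormedSpace.expSeries_div_hasSum_exp (-Real.exp (n * (τ - t)))
      rw [← Real.exp_eq_exp_ℝ] at this
      exact (this.smul_const (h t)).tsum_eq
    simp_rw [htsum] at hsum
    have hsum1 := (hasSum_nat_add_iff' 1).2 hsum
    have hF0 : ∫ t in Ioc 0 T, F 0 t = ∫ t in Ioc 0 T, h t := by simp [F]
    rw [Finset.sum_range_one, hF0] at hsum1
    have hg : HasSum (fun k : ℕ => C * Real.exp (-(n * (T - τ))) * ((1:ℝ) ^ k / k.factorial))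
        (C * Real.exp (-(n * (T - τ))) * Real.exp 1) := by
      have := NormedSpace.expSeries_div_hasSum_exp (1:ℝ)
      rw [← Real.exp_eq_exp_ℝ] at this
      exact this.mul_left _
    refine hsum1.norm_le_of_bounded hg fun k => ?_
    have hFk : ∀ t, F (k + 1) t
        = ((-Real.exp (n * τ)) ^ (k + 1) / ((k + 1).factorial : ℝ)) •
          (Real.exp (-((n * (k + 1) : ℕ) : ℝ) * t) • h t) := by
      intro t
      have h1 : Real.exp (n * (τ - t)) = Real.exp (n * τ) * Real.exp (-(n * t)) := by
        rw [← Real.exp_add]; ring_nf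
      have h2 : Real.exp (-((n * (k + 1) : ℕ) : ℝ) * t) = Real.exp (-(n * t)) ^ (k + 1) := by
        rw [← Real.exp_nat_mul]; push_cast; ring_nf
      simp only [F, smul_smul, h1, h2]
      congr 1
      rw [← neg_mul, mul_pow]
      ring
    simp_rw [hFk]
    rw [integral_smul, norm_smul, norm_div, norm_pow, norm_neg,
      Real.norm_of_nonneg (Real.exp_nonneg _), Real.norm_of_nonneg (Nat.cast_nonneg _)]
    have h3 := hC (n * (k + 1)) (Nat.mul_pos hn k.succ_pos)
    have h4 : Real.exp (-((n * (k + 1) : ℕ) : ℝ) * T) = Real.exp (-(n * T)) ^ (k + 1) := by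
      rw [← Real.exp_nat_mul]; push_cast; ring_nf
    have h5 : Real.exp (n * τ) * Real.exp (-(n * T)) = Real.exp (-(n * (T - τ))) := by
      rw [← Real.exp_add]; ring_nf
    have h6 : Real.exp (-(n * (T - τ))) ≤ 1 := by
      rw [Real.exp_le_one_iff]
      have : 0 < T - τ := sub_pos.2 hτ.2
      simp only [Left.neg_nonpos_iff]
      positivity
    rw [h4] at h3
    calc _ ≤ Real.exp (n * τ) ^ (k + 1) / ((k + 1).factorial : ℝ)
          * (C * Real.exp (-(n * T)) ^ (k + 1)) := by gcongr
      _ = C * (Real.exp (-(n * (T - τ))) ^ (k + 1) / ((k + 1).factorial : ℝ)) := by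
          rw [← h5, mul_pow]; ring
      _ ≤ C * (Real.exp (-(n * (T - τ))) / (k.factorial : ℝ)) := by
          gcongr
          · exact pow_le_of_le_one (Real.exp_nonneg _) h6 k.succ_ne_zero
          · exact k.le_succ
      _ = _ := by rw [one_pow]; ring
  have hnat : Tendsto (fun n : ℕ => (n : ℝ)) atTop atTop := tendsto_natCast_atTop_atTop
  have hlim1 : Tendsto (fun n : ℕ => ∫ t in Ioc 0 T, Real.exp (-Real.exp (n * (τ - t))) • h t)
      atTop (𝓝 (∫ t in Ioc 0 T, (Ioi τ).indicator h t)) := by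
    refine tendsto_integral_of_dominated_convergence (fun t => ‖h t‖) (fun n => ?_) hh.norm
      (fun n => Eventually.of_forall fun t => ?_) ?_
    · exact AEStronglyMeasurable.smul (by fun_prop) hh.aestronglyMeasurable
    · rw [norm_smul, Real.norm_of_nonneg (Real.exp_nonneg _)]
      refine mul_le_of_le_one_left (norm_nonneg _) ?_
      simp [Real.exp_nonneg]
    · have hne : ∀ᵐ t ∂(volume.restrict (Ioc 0 T)), t ≠ τ :=
        ae_restrict_of_ae (Measure.ae_ne volume τ)
      filter_upwards [hne] with t ht
      rcases lt_or_gt_of_ne ht with h1 | h1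
      · have h2 : Tendsto (fun n : ℕ => Real.exp (-Real.exp (n * (τ - t)))) atTop (𝓝 0) :=
          Real.tendsto_exp_atBot.comp (tendsto_neg_atTop_atBot.comp
            (Real.tendsto_exp_atTop.comp (hnat.atTop_mul_const (sub_pos.2 h1))))
        have := h2.smul_const (h t)
        rwa [zero_smul, ← indicator_of_notMem (notMem_Ioi.2 h1.le) h] at this
      · have h2 : Tendsto (fun n : ℕ => Real.exp (-Real.exp (n * (τ - t)))) atTop
            (𝓝 (Real.exp (-0))) :=
          (Real.continuous_exp.tendsto _).comp
            ((Real.tendsto_exp_atBot.comp (hnat.atTop_mul_const_of_neg (sub_neg.2 h1))).neg)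
        have := h2.smul_const (h t)
        rw [indicator_of_mem (mem_Ioi.2 h1)]
        rwa [neg_zero, Real.exp_zero, one_smul] at this
  have hlim2 : Tendsto (fun n : ℕ => C * Real.exp (-(n * (T - τ))) * Real.exp 1) atTop
      (𝓝 (C * 0 * Real.exp 1)) :=
    ((Real.tendsto_exp_atBot.comp (tendsto_neg_atTop_atBot.comp
      (hnat.atTop_mul_const (sub_pos.2 hτ.2)))).const_mul C).mul_const _
  have hzero := le_of_tendsto_of_tendsto (hlim1.sub_const _).norm hlim2
    ((eventually_ge_atTop 1).mono key)
  rw [mul_zero, zero_mul, norm_le_zero_iff, setIntegral_indicator measurableSet_Ioi,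
    sub_eq_zero] at hzero
  have hset : Ioc 0 T ∩ Ioi τ = Ioc τ T := by
    rw [Ioc_inter_Ioi, sup_eq_right.2 hτ.1.le]
  have hsplit : ∫ t in Ioc 0 T, h t = (∫ t in Ioc 0 τ, h t) + ∫ t in Ioc τ T, h t := by
    rw [← Ioc_union_Ioc_eq_Ioc hτ.1.le hτ.2.le]
    exact setIntegral_union (Ioc_disjoint_Ioc_of_le le_rfl) measurableSet_Ioc
      (hh.mono_set (Ioc_subset_Ioc_right hτ.2.le)) (hh.mono_set (Ioc_subset_Ioc_left hτ.1.le))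
  rw [hset, hsplit] at hzero
  simpa using hzero

section LevyMeasure

variable {ν : Measure ℝ}

theorem levyMeasure_Ioi_lt_top
    (hν : ∫⁻ x in Ioi (0:ℝ), ENNReal.ofReal (min 1 x) ∂ν ≠ ⊤) {x : ℝ} (hx : 0 < x) :
    ν (Ioi x) < ⊤ := by
  have hpos : 0 < min 1 x := lt_min one_pos hx
  have h1 : ENNReal.ofReal (min 1 x) * ν (Ioi x)
      ≤ ∫⁻ y in Ioi (0:ℝ), ENNReal.ofReal (min 1 y) ∂ν := by
    rw [← setLIntegral_const]
    calc _ ≤ ∫⁻ y in Ioi x, ENNReal.ofReal (min 1 y) ∂ν := by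
          refine setLIntegral_mono (by fun_prop) fun y hy => ?_
          exact ENNReal.ofReal_le_ofReal (min_le_min_left 1 (le_of_lt hy))
      _ ≤ _ := lintegral_mono_set (Ioi_subset_Ioi hx.le)
  by_contra htop
  rw [not_lt, top_le_iff] at htop
  rw [htop, ENNReal.mul_top (by simpa using hpos), top_le_iff] at h1
  exact hν h1

theorem levyMeasure_tail_antitoneOn
    (hν : ∫⁻ x in Ioi (0:ℝ), ENNReal.ofReal (min 1 x) ∂ν ≠ ⊤) :
    AntitoneOn (fun x => (ν (Ioi x)).toReal) (Ioi 0) := fun _ hx _ _ hxy =>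
  ENNReal.toReal_mono (levyMeasure_Ioi_lt_top hν hx).ne (measure_mono (Ioi_subset_Ioi hxy))

theorem levyMeasure_integrableOn_one_sub_exp
    (hν : ∫⁻ x in Ioi (0:ℝ), ENNReal.ofReal (min 1 x) ∂ν ≠ ⊤) {l : ℝ} (hl : 0 < l) :
    IntegrableOn (fun x => 1 - Real.exp (-l * x)) (Ioi 0) ν := by
  have hmin : IntegrableOn (fun x : ℝ => min 1 x) (Ioi 0) ν := by
    refine ⟨by fun_prop, ?_⟩
    rw [hasFiniteIntegral_iff_ofReal]
    · exact hν.lt_top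
    · filter_upwards [ae_restrict_mem measurableSet_Ioi] with x hx
      exact le_min zero_le_one (le_of_lt hx)
  refine (hmin.const_mul (max 1 l)).mono' (by fun_prop) ?_
  filter_upwards [ae_restrict_mem measurableSet_Ioi] with x hx
  have hx : 0 < x := hx
  have h1 : Real.exp (-l * x) ≤ 1 := Real.exp_le_one_iff.2 (by nlinarith)
  rw [Real.norm_of_nonneg (by linarith)]
  rcases le_total 1 x with h | h
  · rw [min_eq_left h]
    linarith [le_max_left 1 l, Real.exp_pos (-l * x)]
  · rw [min_eq_right h]
    have h2 := Real.add_one_le_exp (-l * x)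
    have h3 : l * x ≤ max 1 l * x := by gcongr; exact le_max_right 1 l
    linarith

/-- The Laplace transform of the tail of a Lévy measure is `φ l / l`. -/
theorem levyMeasure_integral_tail
    (hν : ∫⁻ x in Ioi (0:ℝ), ENNReal.ofReal (min 1 x) ∂ν ≠ ⊤) {l : ℝ} (hl : 0 < l) :
    IntegrableOn (fun s => l * Real.exp (-l * s) * (ν (Ioi s)).toReal) (Ioi 0) ∧
    ∫ s in Ioi 0, l * Real.exp (-l * s) * (ν (Ioi s)).toReal
      = ∫ x in Ioi (0:ℝ), (1 - Real.exp (-l * x)) ∂ν := by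
  have hprim : ∀ x : ℝ, ∫ s in (0:ℝ)..x, l * Real.exp (-l * s) = 1 - Real.exp (-l * x) := by
    intro x
    have hd : ∀ s ∈ uIcc 0 x, HasDerivAt (fun s => -Real.exp (-l * s))
        (l * Real.exp (-l * s)) s := by
      intro s _
      have := ((hasDerivAt_id s).const_mul (-l)).exp.fun_neg
      simpa [mul_comm] using this
    rw [intervalIntegral.integral_eq_sub_of_hasDerivAt hd
      ((by fun_prop : Continuous fun s : ℝ => l * Real.exp (-l * s)).intervalIntegrable _ _)]
    simp
    ring
  have hlc := lintegral_comp_eq_lintegral_meas_lt_mul (ν.restrict (Ioi 0)) (f := fun x => x)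
    (g := fun s => l * Real.exp (-l * s))
    ((ae_restrict_mem measurableSet_Ioi).mono fun x hx => le_of_lt hx) (by fun_prop)
    (fun t _ => (by fun_prop : Continuous fun s : ℝ => l * Real.exp (-l * s)).intervalIntegrable _ _)
    (Eventually.of_forall fun t => by positivity)
  simp_rw [hprim] at hlc
  have hcongr : ∫⁻ t in Ioi 0, (ν.restrict (Ioi 0)) {a | t < a}
        * ENNReal.ofReal (l * Real.exp (-l * t))
      = ∫⁻ t in Ioi 0, ENNReal.ofReal (l * Real.exp (-l * t) * (ν (Ioi t)).toReal) := by
    refine setLIntegral_congr_fun measurableSet_Ioi fun t ht => ?_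
    have h1 : (ν.restrict (Ioi 0)) {a | t < a} = ν (Ioi t) := by
      change (ν.restrict (Ioi 0)) (Ioi t) = _
      rw [Measure.restrict_apply measurableSet_Ioi,
        inter_eq_self_of_subset_left (Ioi_subset_Ioi (le_of_lt ht))]
    rw [h1, ENNReal.ofReal_mul (p := l * Real.exp (-l * t)) (by positivity),
      ENNReal.ofReal_toReal (levyMeasure_Ioi_lt_top hν ht).ne, mul_comm]
  rw [hcongr] at hlc
  have hφ := levyMeasure_integrableOn_one_sub_exp hν hl
  have hφnn : 0 ≤ᵐ[ν.restrict (Ioi 0)] fun x => 1 - Real.exp (-l * x) := by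
    filter_upwards [ae_restrict_mem measurableSet_Ioi] with x hx
    have : Real.exp (-l * x) ≤ 1 := Real.exp_le_one_iff.2 (by nlinarith [mem_Ioi.1 hx])
    simpa using this
  have hwnn : 0 ≤ᵐ[volume.restrict (Ioi 0)]
      fun s => l * Real.exp (-l * s) * (ν (Ioi s)).toReal :=
    Eventually.of_forall fun s => by positivity
  have hmeas : AEStronglyMeasurable (fun s => l * Real.exp (-l * s) * (ν (Ioi s)).toReal)
      (volume.restrict (Ioi 0)) := by
    refine AEStronglyMeasurable.mul (by fun_prop) ?_
    exact (aemeasurable_restrict_of_antitoneOn measurableSet_Ioi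
      (levyMeasure_tail_antitoneOn hν)).aestronglyMeasurable
  refine ⟨⟨hmeas, ?_⟩, ?_⟩
  · rw [hasFiniteIntegral_iff_ofReal hwnn, ← hlc, ← hasFiniteIntegral_iff_ofReal hφnn]
    exact hφ.2
  · rw [integral_eq_lintegral_of_nonneg_ae hwnn hmeas, ← hlc,
      integral_eq_lintegral_of_nonneg_ae hφnn hφ.1]

theorem levyMeasure_laplaceExponent_pos
    (hν : ∫⁻ x in Ioi (0:ℝ), ENNReal.ofReal (min 1 x) ∂ν ≠ ⊤) (hpos : ν (Ioi 0) ≠ 0)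
    {l : ℝ} (hl : 0 < l) : 0 < ∫ x in Ioi (0:ℝ), (1 - Real.exp (-l * x)) ∂ν := by
  have hlt : ∀ x ∈ Ioi (0:ℝ), 0 < 1 - Real.exp (-l * x) := fun x hx => by
    have : Real.exp (-l * x) < 1 := by
      rw [← Real.exp_zero, Real.exp_lt_exp]
      nlinarith [mem_Ioi.1 hx]
    linarith
  rw [setIntegral_pos_iff_support_of_nonneg_ae
    ((ae_restrict_mem measurableSet_Ioi).mono fun x hx => (hlt x hx).le)
    (levyMeasure_integrableOn_one_sub_exp hν hl)]
  rw [inter_eq_self_of_subset_right (fun x hx => Function.mem_support.2 (hlt x hx).ne')]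
  exact pos_iff_ne_zero.2 hpos

theorem levyMeasure_laplaceExponent_mono
    (hν : ∫⁻ x in Ioi (0:ℝ), ENNReal.ofReal (min 1 x) ∂ν ≠ ⊤) {l m : ℝ} (hl : 0 < l)
    (hlm : l ≤ m) : ∫ x in Ioi (0:ℝ), (1 - Real.exp (-l * x)) ∂ν
      ≤ ∫ x in Ioi (0:ℝ), (1 - Real.exp (-m * x)) ∂ν := by
  refine setIntegral_mono_on (levyMeasure_integrableOn_one_sub_exp hν hl)
    (levyMeasure_integrableOn_one_sub_exp hν (hl.trans_le hlm)) measurableSet_Ioi fun x hx => ?_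
  have hx : 0 < x := hx
  gcongr

end LevyMeasure

/-- A continuous function on `[0, T]` with vanishing primitive vanishes. -/
theorem eqOn_zero_of_setIntegral_eq_zero {E : Type*} [NormedAddCommGroup E] [NormedSpace ℝ E]
    [CompleteSpace E] {d : ℝ → E} {T : ℝ} (hT : 0 < T) (hd : ContinuousOn d (Icc 0 T))
    (h0 : ∀ τ ∈ Ioo 0 T, ∫ t in Ioc 0 τ, d t = 0) : EqOn d (fun _ => 0) (Icc 0 T) := by
  refine EqOn.of_subset_closure (s := Ioo 0 T) (fun τ hτ => ?_) hd continuousOn_const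
    Ioo_subset_Icc_self (closure_Ioo hT.ne).ge
  have h1 : HasDerivAt (fun x => ∫ t in (0:ℝ)..x, d t) (d τ) τ := by
    refine intervalIntegral.integral_hasDerivAt_right ?_ ?_
      (hd.continuousAt (Icc_mem_nhds hτ.1 hτ.2))
    · refine (hd.mono ?_).intervalIntegrable
      rw [uIcc_of_le hτ.1.le]
      exact Icc_subset_Icc_right hτ.2.le
    · exact (hd.mono Ioo_subset_Icc_self).stronglyMeasurableAtFilter isOpen_Ioo τ hτ
  refine h1.unique ((hasDerivAt_const τ (0:E)).congr_of_eventuallyEq ?_)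
  filter_upwards [Ioo_mem_nhds hτ.1 hτ.2] with x hx
  rw [intervalIntegral.integral_of_le hx.1.le, h0 x hx]

/-- A continuous solution of the homogeneous equation `∂ᵗ_w d = 𝓛 d` vanishes. -/
theorem homogeneous_strongSolution_eq_zero {E : Type*} [NormedAddCommGroup E] [NormedSpace ℝ E]
    [CompleteSpace E] {ν : Measure ℝ}
    (hν : ∫⁻ x in Ioi (0:ℝ), ENNReal.ofReal (min 1 x) ∂ν ≠ ⊤) (hν0 : ν (Ioi 0) ≠ 0)
    {P : ℝ → E →L[ℝ] E} (hP0 : P 0 = ContinuousLinearMap.id ℝ E)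
    (hP : ∀ s t : ℝ, 0 ≤ s → 0 ≤ t → P (s + t) = (P s).comp (P t))
    {M : ℝ} (hM : ∀ t : ℝ, 0 ≤ t → ‖P t‖ ≤ M)
    (hPcont : ∀ g : E, ContinuousOn (fun t => P t g) (Ici (0:ℝ)))
    {T : ℝ} (hT : 0 < T) {d Ld : ℝ → E} (hd : ContinuousOn d (Icc 0 T))
    (hdom : ∀ᵐ t ∂(volume.restrict (Ioc 0 T)),
      Tendsto (fun h : ℝ => h⁻¹ • (P h (d t) - d t)) (𝓝[>] 0) (𝓝 (Ld t)))
    (hLd : IntegrableOn Ld (Ioc 0 T))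
    (hint : IntegrableOn (fun t => (ν (Ioi (T - t))).toReal • d t) (Ioc 0 T))
    (heq : ∀ x ∈ Ioc 0 T, ∫ t in Ioc 0 x, (ν (Ioi (x - t))).toReal • d t
      = ∫ t in Ioc 0 x, Ld t) :
    EqOn d (fun _ => 0) (Icc 0 T) := by
  have hM0 : 0 ≤ M := (norm_nonneg _).trans (hM 0 le_rfl)
  have hdi : IntegrableOn d (Ioc 0 T) := (hd.integrableOn_Icc).mono_set Ioc_subset_Icc_self
  set φ : ℝ → ℝ := fun l => ∫ x in Ioi (0:ℝ), (1 - Real.exp (-l * x)) ∂ν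
  set C : ℝ := (∫ t in Ioc 0 T, ‖(ν (Ioi (T - t))).toReal • d t‖) + ∫ t in Ioc 0 T, ‖Ld t‖
    with hC
  have hφ1 : 0 < φ 1 := levyMeasure_laplaceExponent_pos hν hν0 one_pos
  have hbound : ∀ l : ℝ, 1 ≤ l → ‖∫ t in Ioc 0 T, Real.exp (-l * t) • d t‖
      ≤ M / φ 1 * C * Real.exp (-l * T) := by
    intro l hl1
    have hl : 0 < l := one_pos.trans_le hl1
    have hφl : φ 1 ≤ φ l := levyMeasure_laplaceExponent_mono hν one_pos hl1
    have hexp : ∀ᵐ t ∂(volume.restrict (Ioc 0 T)), ‖Real.exp (-l * t)‖ ≤ 1 := by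
      filter_upwards [ae_restrict_mem measurableSet_Ioc] with t ht
      rw [Real.norm_of_nonneg (Real.exp_nonneg _), Real.exp_le_one_iff]
      nlinarith [ht.1]
    obtain ⟨htail, htail_eq⟩ := levyMeasure_integral_tail hν hl
    have hK := norm_laplace_convolution_sub_truncation_le hl hT
      (fun x _ => ENNReal.toReal_nonneg) (levyMeasure_tail_antitoneOn hν) htail hdi hint
    have hl' : -l < 0 := neg_lt_zero.2 hl
    have hK1 := norm_laplace_convolution_sub_truncation_le (w := fun _ => 1) hl hT
      (fun x _ => zero_le_one) (fun _ _ _ _ _ => le_rfl)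
      (((integrableOn_exp_mul_Ioi hl' 0).const_mul l).mul_const 1) hLd (by simpa using hLd)
    have hone : ∫ s in Ioi (0:ℝ), l * Real.exp (-l * s) * 1 = 1 := by
      rw [integral_mul_const, integral_const_mul, integral_exp_mul_Ioi hl']
      simp [hl.ne']
    rw [hone] at hK1
    simp only [one_smul] at hK1
    rw [htail_eq, setIntegral_congr_fun measurableSet_Ioc
      (fun x hx => congrArg ((l * Real.exp (-l * x)) • ·) (heq x hx))] at hK
    have hgen := semigroup_generator_integral hP0 hP hM hPcont
      (z := fun t => Real.exp (-l * t) • d t) (Lz := fun t => Real.exp (-l * t) • Ld t)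
      (hdi.bdd_smul (C := 1) (by fun_prop) hexp) (hLd.bdd_smul (C := 1) (by fun_prop) hexp)
      (hdom.mono fun t ht => by
        refine (ht.const_smul (Real.exp (-l * t))).congr fun h => ?_
        rw [map_smul, ← smul_sub, smul_comm])
    have hres := semigroup_resolvent_norm_le hP0 hP hM hPcont hgen (hφ1.trans_le hφl)
    refine hres.trans ?_
    have hsub := (norm_sub_le_norm_sub_add_norm_sub _ _ _).trans
      (add_le_add hK ((norm_sub_rev _ _).trans_le hK1))
    have hφl0 : 0 ≤ M / φ l := div_nonneg hM0 (hφ1.trans_le hφl).le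
    calc _ ≤ M / φ l * (Real.exp (-l * T) * C) := by
          refine mul_le_mul_of_nonneg_left ?_ hφl0
          rw [hC, mul_add]
          exact hsub
      _ ≤ M / φ 1 * (Real.exp (-l * T) * C) := by gcongr
      _ = _ := by ring
  refine eqOn_zero_of_setIntegral_eq_zero hT hd fun τ hτ =>
    setIntegral_eq_zero_of_norm_laplace_le hdi (fun n hn => hbound n ?_) hτ
  exact_mod_cast hn

/-- uniqueness of strong solutions, Theorem 1.1.  A strong solution of
`∂ᵗ_w u = 𝓛u + f` with `u(0) = g` is a bounded continuous `u : [0,T₀] → 𝔹` with `u(0)=g`,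
such that `u(t) ∈ 𝒟(𝓛)` a.e. with integrable generator values `Lu`, and for every
`T ∈ (0,T₀]` the integral `∫₀^T w(T−t)(u(t)−g) dt` converges absolutely and equals
`∫₀^T (f(t)+𝓛u(t)) dt`.  Any two strong solutions coincide on `[0,T₀]`. -/
theorem time_frac_stmt4
    {𝔹 : Type*} [NormedAddCommGroup 𝔹] [NormedSpace ℝ 𝔹] [CompleteSpace 𝔹]
    (ν : Measure ℝ)
    (hν_loc : ∫⁻ x in Set.Ioi (0:ℝ), ENNReal.ofReal (min 1 x) ∂ν ≠ ⊤)
    (hν_inf : ν (Set.Ioi (0:ℝ)) = ⊤)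
    (φ : ℝ → ℝ)
    (hφ : ∀ l : ℝ, 0 < l → φ l = ∫ x in Set.Ioi (0:ℝ), (1 - Real.exp (-l * x)) ∂ν)
    (w : ℝ → ℝ)
    (hw : ∀ x : ℝ, w x = (ν (Set.Ioi x)).toReal)
    (μr : ℝ → Measure ℝ)
    (hprob : ∀ r : ℝ, 0 < r → IsProbabilityMeasure (μr r))
    (hlap : ∀ r : ℝ, 0 < r → ∀ l : ℝ, 0 < l →
      ∫ s, Real.exp (-l * s) ∂(μr r) = Real.exp (-r * φ l))
    (pbar : ℝ → ℝ → ℝ)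
    (hpbar_nn : ∀ r t : ℝ, 0 ≤ pbar r t)
    (hpbar_meas : Measurable (Function.uncurry pbar))
    (hpbar_bdd : ∀ r : ℝ, 0 < r → ∃ C : ℝ, ∀ t : ℝ, pbar r t ≤ C)
    (hdens : ∀ r : ℝ, 0 < r → ∀ A : Set ℝ, MeasurableSet A →
      μr r A = ∫⁻ t in A ∩ Set.Ici 0, ENNReal.ofReal (pbar r t))
    -- uniformly bounded strongly continuous semigroup on 𝔹
    (P : ℝ → 𝔹 →L[ℝ] 𝔹)
    (hP0 : P 0 = ContinuousLinearMap.id ℝ 𝔹)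
    (hPsemi : ∀ s t : ℝ, 0 ≤ s → 0 ≤ t → P (s + t) = (P s).comp (P t))
    (M : ℝ) (hM : ∀ t : ℝ, 0 ≤ t → ‖P t‖ ≤ M)
    (hPcont : ∀ g : 𝔹, ContinuousOn (fun t => P t g) (Set.Ici (0:ℝ)))
    -- data
    (T₀ : ℝ) (hT₀ : 0 < T₀) (g : 𝔹)
    (f : ℝ → 𝔹) (hf_int : IntegrableOn f (Set.Ioc 0 T₀))
    -- u is a strong solution with generator values Lu
    (u Lu : ℝ → 𝔹)
    (hu_cont : ContinuousOn u (Set.Icc (0:ℝ) T₀))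
    (hu0 : u 0 = g)
    (hu_bdd : ∃ C : ℝ, ∀ t ∈ Set.Icc (0:ℝ) T₀, ‖u t‖ ≤ C)
    (hu_dom : ∀ᵐ t ∂(volume.restrict (Set.Ioc (0:ℝ) T₀)),
      Tendsto (fun h : ℝ => h⁻¹ • (P h (u t) - u t)) (nhdsWithin 0 (Set.Ioi (0:ℝ)))
        (nhds (Lu t)))
    (hLu_int : IntegrableOn Lu (Set.Ioc 0 T₀))
    (hu_eq : ∀ T ∈ Set.Ioc (0:ℝ) T₀,
      IntegrableOn (fun t => w (T - t) • (u t - g)) (Set.Ioc 0 T) ∧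
      (∫ t in Set.Ioc (0:ℝ) T, w (T - t) • (u t - g))
        = ∫ t in Set.Ioc (0:ℝ) T, (f t + Lu t))
    -- v is a strong solution with generator values Lv
    (v Lv : ℝ → 𝔹)
    (hv_cont : ContinuousOn v (Set.Icc (0:ℝ) T₀))
    (hv0 : v 0 = g)
    (hv_bdd : ∃ C : ℝ, ∀ t ∈ Set.Icc (0:ℝ) T₀, ‖v t‖ ≤ C)
    (hv_dom : ∀ᵐ t ∂(volume.restrict (Set.Ioc (0:ℝ) T₀)),
      Tendsto (fun h : ℝ => h⁻¹ • (P h (v t) - v t)) (nhdsWithin 0 (Set.Ioi (0:ℝ)))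
        (nhds (Lv t)))
    (hLv_int : IntegrableOn Lv (Set.Ioc 0 T₀))
    (hv_eq : ∀ T ∈ Set.Ioc (0:ℝ) T₀,
      IntegrableOn (fun t => w (T - t) • (v t - g)) (Set.Ioc 0 T) ∧
      (∫ t in Set.Ioc (0:ℝ) T, w (T - t) • (v t - g))
        = ∫ t in Set.Ioc (0:ℝ) T, (f t + Lv t)) :
    ∀ t ∈ Set.Icc (0:ℝ) T₀, u t = v t := by
  obtain rfl : w = fun x => (ν (Ioi x)).toReal := funext hw
  have hdiff : ∀ x : ℝ, (fun t => (ν (Ioi (x - t))).toReal • (u t - v t))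
      = fun t => (ν (Ioi (x - t))).toReal • (u t - g) - (ν (Ioi (x - t))).toReal • (v t - g) := by
    intro x
    ext t
    rw [← smul_sub, sub_sub_sub_cancel_right]
  have hzero := homogeneous_strongSolution_eq_zero hν_loc (by simp [hν_inf]) hP0 hPsemi hM hPcont
    hT₀ (d := fun t => u t - v t) (Ld := fun t => Lu t - Lv t) (hu_cont.sub hv_cont)
    (by
      filter_upwards [hu_dom, hv_dom] with t hu hv
      refine (hu.sub hv).congr fun h => ?_
      rw [map_sub, ← smul_sub, sub_sub_sub_comm])
    (hLu_int.sub hLv_int)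
    (by
      rw [hdiff]
      exact (hu_eq T₀ ⟨hT₀, le_rfl⟩).1.sub (hv_eq T₀ ⟨hT₀, le_rfl⟩).1)
    (by
      intro x hx
      have hsub : Ioc 0 x ⊆ Ioc 0 T₀ := Ioc_subset_Ioc_right hx.2
      rw [hdiff, integral_sub (hu_eq x hx).1 (hv_eq x hx).1, (hu_eq x hx).2, (hv_eq x hx).2,
        integral_add (hf_int.mono_set hsub) (hLu_int.mono_set hsub),
        integral_add (hf_int.mono_set hsub) (hLv_int.mono_set hsub),
        integral_sub (hLu_int.mono_set hsub) (hLv_int.mono_set hsub), add_sub_add_left_eq_sub])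
  exact fun t ht => sub_eq_zero.1 (hzero ht)
end
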